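/- arXiv:math/0504391 — 2 statements merged into one kernel-verified Lean document; each statement's English description precedes it below -/
import Mathlib

section
/- Let d = 1, p ∈ (1,2], m > 1 + p, and let A : ℝ → ℝ be locally Hölder continuous and positive with A(x) ≥ C(1+|x|)^m for all x and some C > 0. Let α, β : ℝ → ℝ be locally Hölder continuous with 0 < α, sup_{x∈ℝ} α(x) < ∞, and 0 ≤ β bounded from above. Then there exists a function u : ℝ × [0,∞) → ℝ, not identically zero, that is continuous, nonnegative, twice continuously differentiable in x and once in t on ℝ × (0,∞), satisfies ∂u/∂t = A(x)u_{xx} + β(x)u − α(x)u^p on ℝ × (0,∞), and satisfies u(x,0) = 0 for all x ∈ ℝ. -/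
open Set

/-- `f : ℝ → ℝ` is locally Hölder continuous. -/
def LocHolder1 (f : ℝ → ℝ) : Prop :=
  ∀ K : Set ℝ, IsCompact K →
    ∃ κ C : ℝ, 0 < κ ∧ κ ≤ 1 ∧ 0 ≤ C ∧
      ∀ x ∈ K, ∀ y ∈ K, |f x - f y| ≤ C * |x - y| ^ κ

section

open Filter Topology

theorem LocHolder1.continuous {f : ℝ → ℝ} (hf : LocHolder1 f) : Continuous f := by
  rw [continuous_iff_continuousAt]
  intro x
  obtain ⟨κ, C, hκ, -, hC, h⟩ := hf (Icc (x - 1) (x + 1)) isCompact_Icc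
  have hlim : Tendsto (fun y => C * |y - x| ^ κ) (𝓝 x) (𝓝 0) := by
    have : ContinuousAt (fun y => C * |y - x| ^ κ) x := by
      apply ContinuousAt.mul continuousAt_const
      exact ContinuousAt.rpow_const (by fun_prop) (Or.inr hκ.le)
    have h2 := this.tendsto
    simpa [Real.zero_rpow hκ.ne'] using h2
  rw [ContinuousAt, tendsto_iff_dist_tendsto_zero]
  refine squeeze_zero' (Eventually.of_forall fun y => dist_nonneg) ?_ hlim
  filter_upwards [Icc_mem_nhds (show x - 1 < x by linarith) (show x < x + 1 by linarith)] with y hy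
  rw [Real.dist_eq]
  exact h y hy x ⟨by linarith, by linarith⟩

/-- Superadditivity of increments of the convex function `v ↦ v ^ p`. -/
theorem rpow_add_rpow_le_of_add_le {p a b c d : ℝ} (hp : 1 ≤ p) (hd : 0 ≤ d) (hdb : d ≤ b)
    (hdc : d ≤ c) (h : b + c ≤ a + d) : b ^ p + c ^ p ≤ a ^ p + d ^ p := by
  have hconv := convexOn_rpow hp
  have hmono : (b + c - d) ^ p ≤ a ^ p :=
    Real.rpow_le_rpow (by linarith) (by linarith) (by linarith)
  suffices b ^ p + c ^ p ≤ (b + c - d) ^ p + d ^ p by linarith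
  rcases eq_or_lt_of_le (show d ≤ b + c - d by linarith) with heq | hlt
  · have hb : b = d := by linarith
    have hc : c = d := by linarith
    subst hb; rw [hc]; simp
  · set e := b + c - d with he
    have hed : 0 < e - d := by linarith
    have hde : e - d ≠ 0 := hed.ne'
    have hb := hconv.2 (show d ∈ Ici (0 : ℝ) from hd) (show e ∈ Ici (0 : ℝ) by simp; linarith)
      (show 0 ≤ (e - b) / (e - d) by apply div_nonneg <;> linarith)
      (show 0 ≤ (b - d) / (e - d) by apply div_nonneg <;> linarith) (by field_simp; ring)
    have hc := hconv.2 (show d ∈ Ici (0 : ℝ) from hd) (show e ∈ Ici (0 : ℝ) by simp; linarith)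
      (show 0 ≤ (e - c) / (e - d) by apply div_nonneg <;> linarith)
      (show 0 ≤ (c - d) / (e - d) by apply div_nonneg <;> linarith) (by field_simp; ring)
    have e1 : (e - b) / (e - d) * d + (b - d) / (e - d) * e = b := by field_simp; ring
    have e2 : (e - c) / (e - d) * d + (c - d) / (e - d) * e = c := by field_simp; ring
    simp only [smul_eq_mul, e1, e2] at hb hc
    have e3 : (e - b) / (e - d) + (e - c) / (e - d) = 1 := by field_simp; linarith
    have e4 : (b - d) / (e - d) + (c - d) / (e - d) = 1 := by field_simp; linarith
    calc b ^ p + c ^ p ≤ ((e - b) / (e - d) + (e - c) / (e - d)) * d ^ p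
          + ((b - d) / (e - d) + (c - d) / (e - d)) * e ^ p := by linarith
      _ = e ^ p + d ^ p := by rw [e3, e4]; ring

theorem rpow_sub_rpow_le_mul_sub {p x y M : ℝ} (hp : 1 ≤ p) (hy : 0 ≤ y) (hyx : y ≤ x) (hx : x ≤ M) :
    x ^ p - y ^ p ≤ p * M ^ (p - 1) * (x - y) := by
  rcases eq_or_lt_of_le hyx with rfl | hlt
  · simp
  have hx0 : 0 < x := by linarith
  have h := (convexOn_rpow hp).slope_le_of_hasDerivAt (show y ∈ Ici (0 : ℝ) from hy)
    (show x ∈ Ici (0 : ℝ) from hx0.le) hlt (Real.hasDerivAt_rpow_const (Or.inl hx0.ne'))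
  rw [slope_def_field, div_le_iff₀ (by linarith)] at h
  refine h.trans ?_
  have : x ^ (p - 1) ≤ M ^ (p - 1) := Real.rpow_le_rpow hx0.le hx (by linarith)
  have hxy : 0 ≤ x - y := by linarith
  gcongr

theorem abs_rpow_sub_rpow_le {p x y M : ℝ} (hp : 1 ≤ p) (hx0 : 0 ≤ x) (hy0 : 0 ≤ y) (hx : x ≤ M)
    (hy : y ≤ M) : |x ^ p - y ^ p| ≤ p * M ^ (p - 1) * |x - y| := by
  rcases le_total y x with h | h
  · have h1 : y ^ p ≤ x ^ p := Real.rpow_le_rpow hy0 h (by linarith)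
    rw [abs_of_nonneg (by linarith), abs_of_nonneg (by linarith)]
    exact rpow_sub_rpow_le_mul_sub hp hy0 h hx
  · have h1 : x ^ p ≤ y ^ p := Real.rpow_le_rpow hx0 h (by linarith)
    rw [abs_sub_comm, abs_sub_comm x y, abs_of_nonneg (by linarith), abs_of_nonneg (by linarith)]
    exact rpow_sub_rpow_le_mul_sub hp hx0 h hy

/-- Second differences of the concave power `x ↦ x ^ q` are quantitatively negative. -/
theorem rpow_add_add_rpow_sub_le {q X h : ℝ} (hq0 : 0 < q) (hq1 : q < 1) (hh : 0 ≤ h) (hX : h < X) :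
    (X + h) ^ q + (X - h) ^ q - 2 * X ^ q ≤ -(q * (1 - q) / 2 * X ^ (q - 2) * h ^ 2) := by
  have hX0 : 0 < X := by linarith
  set F : ℝ → ℝ := fun s => (X + s) ^ q + (X - s) ^ q + q * (1 - q) / 2 * X ^ (q - 2) * s ^ 2 with hF
  have hder : ∀ s ∈ Icc 0 h, HasDerivAt F (q * (X + s) ^ (q - 1) - q * (X - s) ^ (q - 1)
      + q * (1 - q) * X ^ (q - 2) * s) s := by
    intro s hs
    have h1 : HasDerivAt (fun s => (X + s) ^ q) (1 * q * (X + s) ^ (q - 1)) s :=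
      ((hasDerivAt_id s).const_add X).rpow_const (Or.inl (by simp only [id]; linarith [hs.1]))
    have h2 : HasDerivAt (fun s => (X - s) ^ q) (-1 * q * (X - s) ^ (q - 1)) s :=
      ((hasDerivAt_id s).const_sub X).rpow_const (Or.inl (by simp only [id]; linarith [hs.2]))
    have h3 := (hasDerivAt_pow 2 s).const_mul (q * (1 - q) / 2 * X ^ (q - 2))
    exact ((h1.add h2).add h3).congr_deriv (by push_cast; ring)
  have hneg : ∀ s ∈ Icc 0 h, q * (X + s) ^ (q - 1) - q * (X - s) ^ (q - 1)
      + q * (1 - q) * X ^ (q - 2) * s ≤ 0 := by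
    intro s hs
    have hsX : 0 < X - s := by linarith [hs.2]
    have h1 : (X + s) ^ (q - 1) ≤ X ^ (q - 1) :=
      Real.rpow_le_rpow_of_nonpos hX0 (by linarith [hs.1]) (by linarith)
    have h2 : X ^ (q - 1) + (1 - q) * X ^ (q - 2) * s ≤ (X - s) ^ (q - 1) := by
      set y := s / X with hy
      have hy0 : 0 ≤ y := div_nonneg hs.1 hX0.le
      have hy1 : y < 1 := by rw [hy, div_lt_one hX0]; linarith
      have e1 : X - s = X * (1 - y) := by rw [hy]; field_simp
      have e2 : X ^ (q - 2) * s = X ^ (q - 1) * y := by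
        rw [hy, show q - 2 = (q - 1) - 1 by ring, Real.rpow_sub_one hX0.ne']; field_simp
      have hb : (1 - y) ^ (1 - q) ≤ 1 - (1 - q) * y := by
        have := rpow_one_add_le_one_add_mul_self (s := -y) (p := 1 - q) (by linarith)
          (by linarith) (by linarith)
        calc (1 - y) ^ (1 - q) = (1 + -y) ^ (1 - q) := by ring_nf
          _ ≤ _ := this
          _ = _ := by ring
      have hpos : 0 < (1 - y) ^ (1 - q) := Real.rpow_pos_of_pos (by linarith) _
      have hb2 : 1 + (1 - q) * y ≤ (1 - y) ^ (q - 1) := by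
        rw [show q - 1 = -(1 - q) by ring, Real.rpow_neg (by linarith), le_inv_comm₀ (by nlinarith) hpos]
        refine hb.trans ?_
        rw [le_inv_comm₀ (by nlinarith) (by nlinarith), ← one_div, le_div_iff₀ (by nlinarith)]
        nlinarith [sq_nonneg ((1 - q) * y)]
      rw [e1, Real.mul_rpow hX0.le (by linarith), mul_assoc, e2]
      have := mul_le_mul_of_nonneg_left hb2 (Real.rpow_nonneg hX0.le (q - 1))
      linarith
    nlinarith
  have hanti : AntitoneOn F (Icc 0 h) := by
    apply antitoneOn_of_hasDerivWithinAt_nonpos (convex_Icc 0 h)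
      (f' := fun s => q * (X + s) ^ (q - 1) - q * (X - s) ^ (q - 1) + q * (1 - q) * X ^ (q - 2) * s)
    · exact fun s hs => (hder s hs).continuousAt.continuousWithinAt
    · intro s hs; exact (hder s (interior_subset hs)).hasDerivWithinAt
    · intro s hs; exact hneg s (interior_subset hs)
  have := hanti (left_mem_Icc.2 hh) (right_mem_Icc.2 hh) hh
  simp only [hF] at this
  norm_num at this
  linarith

/-- A `C^{1,1}` regularisation of `|x|`: quadratic on `[-1, 1]` and equal to `|x|` outside. -/
noncomputable def softAbs (x : ℝ) : ℝ := if |x| ≤ 1 then (1 + x ^ 2) / 2 else |x|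

theorem softAbs_of_one_le {x : ℝ} (hx : 1 ≤ |x|) : softAbs x = |x| := by
  unfold softAbs
  split_ifs with h
  · have : |x| = 1 := le_antisymm h hx
    rw [← sq_abs, this]; norm_num
  · rfl

theorem half_le_softAbs (x : ℝ) : 1 / 2 ≤ softAbs x := by
  unfold softAbs
  split_ifs with h <;> nlinarith [sq_nonneg x]

theorem softAbs_pos (x : ℝ) : 0 < softAbs x := by linarith [half_le_softAbs x]

theorem softAbs_le (x : ℝ) : softAbs x ≤ 1 + |x| := by
  unfold softAbs
  split_ifs with h
  · rw [← sq_abs]; nlinarith [abs_nonneg x]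
  · linarith

theorem softAbs_add_add_softAbs_sub_le (x h : ℝ) :
    softAbs (x + h) + softAbs (x - h) - 2 * softAbs x ≤ h ^ 2 := by
  have key : ∀ c y : ℝ, |c| ≤ 1 → c * y + (1 - c ^ 2) / 2 ≤ softAbs y := by
    intro c y hc
    unfold softAbs
    split_ifs with hy
    · nlinarith [sq_nonneg (c - y)]
    · have h1 : c * y ≤ |c| * |y| := by rw [← abs_mul]; exact le_abs_self _
      rw [← sq_abs c]
      nlinarith [abs_nonneg c]
  have up : ∀ c y : ℝ, |c| ≤ 1 → softAbs y ≤ c * y + (1 - c ^ 2) / 2 + (y - c) ^ 2 / 2 := by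
    intro c y hc
    have : softAbs y ≤ (1 + y ^ 2) / 2 := by
      unfold softAbs
      split_ifs with hy
      · rfl
      · rw [← sq_abs y]; nlinarith [sq_nonneg (|y| - 1)]
    nlinarith
  rcases le_or_gt |x| 1 with hx | hx
  · have h1 := up x (x + h) hx
    have h2 := up x (x - h) hx
    have h3 := key x x hx
    nlinarith
  · have gen : ∀ z k : ℝ, 1 < z → softAbs (z + k) ≤ z + k + k ^ 2 / 2 := by
      intro z k hz
      unfold softAbs
      split_ifs with hy
      · have := abs_le.1 hy; nlinarith
      · rcases abs_cases (z + k) with ⟨h, -⟩ | ⟨h, -⟩ <;> rw [h] <;> nlinarith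
    have hxs := softAbs_of_one_le hx.le
    have neg : ∀ y, softAbs (-y) = softAbs y := by intro y; simp [softAbs]
    rcases lt_abs.1 hx with h1 | h1
    · have a := gen x h h1
      have b := gen x (-h) h1
      rw [hxs, abs_of_pos (by linarith)]
      rw [← sub_eq_add_neg] at b
      nlinarith
    · have a := gen (-x) h h1
      have b := gen (-x) (-h) h1
      rw [← neg, show -(-x + h) = x - h by ring] at a
      rw [← neg, show -(-x + -h) = x + h by ring] at b
      rw [hxs, abs_of_neg (by linarith)]
      nlinarith

theorem softAbs_add_add_softAbs_sub_eq {x h : ℝ} (hh : |h| ≤ 1) (hx : 2 ≤ |x|) :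
    softAbs (x + h) + softAbs (x - h) - 2 * softAbs x = 0 := by
  obtain ⟨h1, h2⟩ := abs_le.1 hh
  rcases le_abs.1 hx with hx' | hx'
  · have a : softAbs (x + h) = x + h := by
      rw [softAbs_of_one_le] <;> rw [abs_of_pos] <;> linarith
    have b : softAbs (x - h) = x - h := by
      rw [softAbs_of_one_le] <;> rw [abs_of_pos] <;> linarith
    have c : softAbs x = x := by
      rw [softAbs_of_one_le] <;> rw [abs_of_pos] <;> linarith
    rw [a, b, c]; ring
  · have a : softAbs (x + h) = -(x + h) := by
      rw [softAbs_of_one_le] <;> rw [abs_of_neg] <;> linarith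
    have b : softAbs (x - h) = -(x - h) := by
      rw [softAbs_of_one_le] <;> rw [abs_of_neg] <;> linarith
    have c : softAbs x = -x := by
      rw [softAbs_of_one_le] <;> rw [abs_of_neg] <;> linarith
    rw [a, b, c]; ring

theorem add_add_sub_le_of_forall_secondDiff_le {f : ℤ → ℝ} {c : ℝ} {i : ℤ} {k : ℕ}
    (h : ∀ j, |j - i| < k → f (j + 1) + f (j - 1) - 2 * f j ≤ c) :
    f (i + k) + f (i - k) - 2 * f i ≤ c * (k : ℝ) ^ 2 := by
  have aux : ∀ l : ℕ, l < k →
      (f (i + (l + 1 : ℕ)) + f (i - (l + 1 : ℕ))) - (f (i + l) + f (i - l)) ≤ c * (2 * l + 1) := by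
    intro l
    induction l with
    | zero =>
      intro hl
      have := h i (by simpa using hl)
      simp only [zero_add, Nat.cast_one, Nat.cast_zero, add_zero, sub_zero, mul_zero, mul_one]
      linarith
    | succ l ih =>
      intro hl
      have h0 := ih (by omega)
      have h1 := h (i + (l + 1 : ℕ)) (by rw [abs_lt]; constructor <;> omega)
      have h2 := h (i - (l + 1 : ℕ)) (by rw [abs_lt]; constructor <;> omega)
      rw [show i + ((l + 1 : ℕ) : ℤ) + 1 = i + ((l + 1 + 1 : ℕ) : ℤ) by push_cast; ring,
        show i + ((l + 1 : ℕ) : ℤ) - 1 = i + (l : ℤ) by push_cast; ring] at h1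
      rw [show i - ((l + 1 : ℕ) : ℤ) - 1 = i - ((l + 1 + 1 : ℕ) : ℤ) by push_cast; ring,
        show i - ((l + 1 : ℕ) : ℤ) + 1 = i - (l : ℤ) by push_cast; ring] at h2
      push_cast at *
      linarith
  have main : ∀ l : ℕ, l ≤ k → f (i + l) + f (i - l) - 2 * f i ≤ c * (l : ℝ) ^ 2 := by
    intro l
    induction l with
    | zero => intro _; simp; linarith
    | succ l ih =>
      intro hl
      have h0 := ih (by omega)
      have h1 := aux l (by omega)
      push_cast at *
      nlinarith
  exact main k le_rfl

/-- A bounded discretely semiconcave function is Lipschitz. -/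
theorem abs_sub_le_of_secondDiff_le {f : ℤ → ℝ} {K M : ℝ} {i : ℤ} {n : ℕ} (hn : 1 ≤ n)
    (hK : 0 ≤ K) (hf0 : ∀ j, |j - i| ≤ n + 1 → 0 ≤ f j) (hfM : ∀ j, |j - i| ≤ n + 1 → f j ≤ M)
    (h : ∀ j, |j - i| ≤ n → f (j + 1) + f (j - 1) - 2 * f j ≤ K / (n : ℝ) ^ 2) :
    |f (i + 1) - f i| ≤ (M + K) / n := by
  have hn0 : (0 : ℝ) < n := by exact_mod_cast hn
  set κ := K / (n : ℝ) ^ 2 with hκ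
  have hκ0 : 0 ≤ κ := by positivity
  have hκn : κ * (n : ℝ) ^ 2 = K := by rw [hκ]; field_simp
  set d := f (i + 1) - f i with hd
  have up : ∀ k : ℕ, k ≤ n → f (i + k + 1) - f (i + k) ≤ d + k * κ := by
    intro k
    induction k with
    | zero => intro _; simp [hd]
    | succ k ih =>
      intro hk
      have h0 := ih (by omega)
      have h1 := h (i + (k + 1 : ℕ)) (by rw [abs_le]; constructor <;> omega)
      rw [show i + ((k + 1 : ℕ) : ℤ) - 1 = i + k by push_cast; ring] at h1
      rw [show i + (k : ℤ) + 1 = i + ((k + 1 : ℕ) : ℤ) by push_cast; ring] at h0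
      push_cast at *
      linarith
  have dn : ∀ k : ℕ, k ≤ n → d - k * κ ≤ f (i - k + 1) - f (i - k) := by
    intro k
    induction k with
    | zero => intro _; simp [hd]
    | succ k ih =>
      intro hk
      have h0 := ih (by omega)
      have h1 := h (i - k) (by rw [abs_le]; constructor <;> omega)
      rw [show i - ((k + 1 : ℕ) : ℤ) + 1 = i - k by push_cast; ring,
        show i - ((k + 1 : ℕ) : ℤ) = i - k - 1 by push_cast; ring]
      push_cast at *
      linarith
  have up2 : ∀ k : ℕ, k ≤ n → f (i + 1 + k) - f (i + 1) ≤ k * (d + n * κ) := by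
    intro k
    induction k with
    | zero => intro _; simp
    | succ k ih =>
      intro hk
      have h0 := ih (by omega)
      have h1 := up (k + 1) hk
      have h2 : ((k + 1 : ℕ) : ℝ) * κ ≤ n * κ := by gcongr
      rw [show i + ((k + 1 : ℕ) : ℤ) + 1 = i + 1 + ((k + 1 : ℕ) : ℤ) by ring,
        show i + ((k + 1 : ℕ) : ℤ) = i + 1 + k by push_cast; ring] at h1
      push_cast at *
      linarith
  have dn2 : ∀ k : ℕ, k ≤ n → k * (d - n * κ) ≤ f i - f (i - k) := by
    intro k
    induction k with
    | zero => intro _; simp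
    | succ k ih =>
      intro hk
      have h0 := ih (by omega)
      have h1 := dn (k + 1) hk
      have h2 : ((k + 1 : ℕ) : ℝ) * κ ≤ n * κ := by gcongr
      rw [show i - ((k + 1 : ℕ) : ℤ) + 1 = i - k by push_cast; ring] at h1
      push_cast at *
      linarith
  have a1 := up2 n le_rfl
  have a2 := dn2 n le_rfl
  have b1 := hf0 (i + 1 + n) (by rw [abs_le]; constructor <;> omega)
  have b2 := hfM (i + 1) (by rw [abs_le]; constructor <;> omega)
  have b3 := hf0 (i - n) (by rw [abs_le]; constructor <;> omega)
  have b4 := hfM i (by rw [abs_le]; constructor <;> omega)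
  rw [abs_le]
  constructor
  · rw [← neg_div, div_le_iff₀ hn0]
    nlinarith
  · rw [le_div_iff₀ hn0]
    nlinarith

theorem le_chord_of_schwarz_nonneg {g : ℝ → ℝ} (hg : Continuous g)
    (h : ∀ x, ∀ ε > 0, ∃ δ > 0, ∀ η, 0 < η → η < δ →
      -(ε * η ^ 2) ≤ g (x + η) + g (x - η) - 2 * g x)
    {a b x : ℝ} (hax : a < x) (hxb : x < b) :
    g x ≤ g a + (g b - g a) / (b - a) * (x - a) := by
  have hab : 0 < b - a := by linarith
  by_contra! hcon
  set s := (g b - g a) / (b - a) with hs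
  have hsb : s * (b - a) = g b - g a := by rw [hs]; field_simp
  set D := g x - (g a + s * (x - a)) with hD
  have hDpos : 0 < D := by linarith
  have hw : 0 < (x - a) * (b - x) := mul_pos (by linarith) (by linarith)
  set ε := D / (2 * ((x - a) * (b - x))) with hε
  have hεpos : 0 < ε := by positivity
  set G : ℝ → ℝ := fun y => g y - (g a + s * (y - a)) + ε * ((y - a) * (y - b)) with hG
  have hGc : Continuous G := by fun_prop
  obtain ⟨z, hz, hmax⟩ := isCompact_Icc.exists_isMaxOn (nonempty_Icc.2 (by linarith : a ≤ b))
    hGc.continuousOn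
  have hGx : 0 < G x := by
    have : ε * ((x - a) * (b - x)) = D / 2 := by
      rw [hε, div_mul_eq_mul_div, mul_div_mul_right _ _ hw.ne']
    simp only [hG]; nlinarith
  have hGz : 0 < G z := hGx.trans_le (hmax ⟨hax.le, hxb.le⟩)
  have hza : a < z := by
    rcases eq_or_lt_of_le hz.1 with h1 | h1
    · rw [← h1] at hGz; simp [hG] at hGz
    · exact h1
  have hzb : z < b := by
    rcases eq_or_lt_of_le hz.2 with h1 | h1
    · rw [h1] at hGz; simp only [hG] at hGz; nlinarith
    · exact h1
  obtain ⟨δ, hδ, hδh⟩ := h z ε hεpos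
  set η := min (δ / 2) (min (z - a) (b - z)) with hη
  have hηpos : 0 < η := by
    apply lt_min (by linarith); apply lt_min <;> linarith
  have h1 : η ≤ δ / 2 := min_le_left _ _
  have h2 : η ≤ z - a := (min_le_right _ _).trans (min_le_left _ _)
  have h3 : η ≤ b - z := (min_le_right _ _).trans (min_le_right _ _)
  have k1 := hδh η hηpos (by linarith)
  have k2 : G (z + η) ≤ G z := hmax ⟨by linarith, by linarith⟩
  have k3 : G (z - η) ≤ G z := hmax ⟨by linarith, by linarith⟩
  have hη2 : 0 < ε * η ^ 2 := by positivity
  simp only [hG] at k2 k3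
  nlinarith

theorem eq_affine_of_schwarz_eq_zero {g : ℝ → ℝ} (hg : Continuous g)
    (h : ∀ x, ∀ ε > 0, ∃ δ > 0, ∀ η, 0 < η → η < δ →
      |g (x + η) + g (x - η) - 2 * g x| ≤ ε * η ^ 2) (x : ℝ) :
    g x = g 0 + (g 1 - g 0) * x := by
  have chord : ∀ {a b x : ℝ}, a < x → x < b → (g x - g a) * (b - a) = (g b - g a) * (x - a) := by
    intro a b x hax hxb
    have hab : b - a ≠ 0 := by linarith
    have h1 := le_chord_of_schwarz_nonneg hg (fun x ε hε => by
      obtain ⟨δ, hδ, hd⟩ := h x ε hε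
      exact ⟨δ, hδ, fun η h0 h1 => (abs_le.1 (hd η h0 h1)).1⟩) hax hxb
    have h2 := le_chord_of_schwarz_nonneg (g := fun y => -g y) hg.neg (fun x ε hε => by
      obtain ⟨δ, hδ, hd⟩ := h x ε hε
      exact ⟨δ, hδ, fun η h0 h1 => by have := (abs_le.1 (hd η h0 h1)).2; linarith⟩) hax hxb
    have h3 : g x = g a + (g b - g a) / (b - a) * (x - a) := by
      apply le_antisymm h1
      have : (-g b - -g a) / (b - a) = - ((g b - g a) / (b - a)) := by ring
      rw [this] at h2
      linarith
    rw [h3]; field_simp; ring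
  rcases lt_trichotomy x 0 with h0 | h0 | h0
  · have := chord h0 one_pos
    linarith
  · subst h0; simp
  · rcases lt_trichotomy x 1 with h1 | h1 | h1
    · have := chord h0 h1; linarith
    · subst h1; ring
    · have := chord one_pos h1; linarith

/-- A continuous function whose Schwarz (symmetric) second derivative is a continuous function `r`
is of class `C²` with second derivative `r`. -/
theorem contDiff_two_of_schwarz {f r : ℝ → ℝ} (hf : Continuous f) (hr : Continuous r)
    (h : ∀ x, ∀ ε > 0, ∃ δ > 0, ∀ η, 0 < η → η < δ →
      |f (x + η) + f (x - η) - 2 * f x - r x * η ^ 2| ≤ ε * η ^ 2) :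
    ContDiff ℝ 2 f ∧ ∀ x, deriv (deriv f) x = r x := by
  set R1 : ℝ → ℝ := fun x => ∫ y in (0 : ℝ)..x, r y with hR1
  have hR1d : ∀ x, HasDerivAt R1 (r x) x := fun x =>
    intervalIntegral.integral_hasDerivAt_right (hr.intervalIntegrable _ _)
      (hr.stronglyMeasurableAtFilter _ _) hr.continuousAt
  have hR1c : Continuous R1 := continuous_iff_continuousAt.2 fun x => (hR1d x).continuousAt
  set R : ℝ → ℝ := fun x => ∫ y in (0 : ℝ)..x, R1 y with hR
  have hRd : ∀ x, HasDerivAt R (R1 x) x := fun x =>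
    intervalIntegral.integral_hasDerivAt_right (hR1c.intervalIntegrable _ _)
      (hR1c.stronglyMeasurableAtFilter _ _) hR1c.continuousAt
  have hRc : Continuous R := continuous_iff_continuousAt.2 fun x => (hRd x).continuousAt
  have hRs : ∀ x, ∀ ε > 0, ∃ δ > 0, ∀ η, 0 < η → η < δ →
      |R (x + η) + R (x - η) - 2 * R x - r x * η ^ 2| ≤ ε * η ^ 2 := by
    intro x ε hε
    obtain ⟨δ, hδ, hd⟩ := Metric.continuous_iff.1 hr x (ε / 2) (by linarith)
    refine ⟨δ, hδ, fun η h0 h1 => ?_⟩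
    set S : ℝ → ℝ := fun η => R (x + η) + R (x - η) - r x * η ^ 2 with hS
    have hSd : ∀ s, HasDerivAt S (R1 (x + s) - R1 (x - s) - r x * (2 * s)) s := by
      intro s
      have a1 : HasDerivAt (fun s => R (x + s)) (R1 (x + s)) s := by
        simpa using (hRd (x + s)).comp_const_add x s
      have a2 : HasDerivAt (fun s => R (x - s)) (-R1 (x - s)) s := (hRd (x - s)).comp_const_sub x s
      have a3 := (hasDerivAt_pow 2 s).const_mul (r x)
      exact ((a1.add a2).sub a3).congr_deriv (by push_cast; ring)
    have hSb : ∀ s ∈ Ico 0 η, ‖R1 (x + s) - R1 (x - s) - r x * (2 * s)‖ ≤ ε * η := by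
      intro s hs
      have e1 : R1 (x + s) - R1 (x - s) - r x * (2 * s) = ∫ y in (x - s)..(x + s), (r y - r x) := by
        rw [intervalIntegral.integral_sub (hr.intervalIntegrable _ _) (by simp),
          intervalIntegral.integral_const, smul_eq_mul]
        simp only [hR1]
        rw [intervalIntegral.integral_interval_sub_left (hr.intervalIntegrable _ _)
          (hr.intervalIntegrable _ _)]
        ring
      rw [e1]
      refine (intervalIntegral.norm_integral_le_of_norm_le_const (C := ε / 2) ?_).trans ?_
      · intro y hy
        rw [uIoc_of_le (by linarith [hs.1])] at hy
        rw [← dist_eq_norm]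
        refine (hd y ?_).le
        rw [Real.dist_eq, abs_lt]
        constructor <;> linarith [hy.1, hy.2, hs.2]
      · rw [show x + s - (x - s) = 2 * s by ring, abs_of_nonneg (by linarith [hs.1])]
        nlinarith [hs.2]
    have := norm_image_sub_le_of_norm_deriv_le_segment' (f := S) (a := 0) (b := η)
      (fun s _ => (hSd s).hasDerivWithinAt) hSb η (right_mem_Icc.2 h0.le)
    rw [Real.norm_eq_abs] at this
    simp only [hS] at this
    calc _ = |R (x + η) + R (x - η) - r x * η ^ 2 - (R (x + 0) + R (x - 0) - r x * 0 ^ 2)| := by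
          congr 1; simp; ring
      _ ≤ _ := this
      _ = _ := by ring
  have haff := eq_affine_of_schwarz_eq_zero (g := fun x => f x - R x) (hf.sub hRc) (by
    intro x ε hε
    obtain ⟨δ, hδ, hd⟩ := h x (ε / 2) (by linarith)
    obtain ⟨δ', hδ', hd'⟩ := hRs x (ε / 2) (by linarith)
    refine ⟨min δ δ', lt_min hδ hδ', fun η h0 h1 => ?_⟩
    have k1 := abs_le.1 (hd η h0 (h1.trans_le (min_le_left _ _)))
    have k2 := abs_le.1 (hd' η h0 (h1.trans_le (min_le_right _ _)))
    rw [abs_le]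
    constructor <;> linarith [k1.1, k1.2, k2.1, k2.2])
  set c := f 1 - R 1 - (f 0 - R 0) with hc
  have hfe : f = fun x => R x + (f 0 - R 0 + c * x) := by
    funext x; linarith [haff x]
  have hfd : ∀ x, HasDerivAt f (R1 x + c) x := by
    intro x
    rw [hfe]
    exact ((hRd x).add (((hasDerivAt_id x).const_mul c).const_add (f 0 - R 0))).congr_deriv (by simp)
  have hdf : deriv f = fun x => R1 x + c := funext fun x => (hfd x).deriv
  have hddf : deriv (deriv f) = r := by
    funext x; rw [hdf]; exact ((hR1d x).add_const c).deriv
  refine ⟨?_, fun x => by rw [hddf]⟩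
  rw [show (2 : WithTop ℕ∞) = 1 + 1 by norm_num, contDiff_succ_iff_deriv]
  refine ⟨fun x => (hfd x).differentiableAt, by simp, ?_⟩
  rw [contDiff_one_iff_deriv, hddf]
  refine ⟨?_, hr⟩
  rw [hdf]
  exact fun x => ((hR1d x).add_const c).differentiableAt

theorem HasDerivWithinAt.nonneg_of_forall_le_left {f : ℝ → ℝ} {f' a b t : ℝ}
    (hf : HasDerivWithinAt f f' (Icc a b) t) (ht : t ∈ Ioc a b) (h : ∀ s ∈ Icc a b, f s ≤ f t) :
    0 ≤ f' := by
  have h1 : HasDerivWithinAt f f' (Ico a t) t :=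
    hf.mono fun s hs => ⟨hs.1, hs.2.le.trans ht.2⟩
  have h2 := (hasDerivWithinAt_iff_tendsto_slope' (by simp)).1 h1
  have : (𝓝[Ico a t] t).NeBot := by
    rw [← mem_closure_iff_nhdsWithin_neBot, closure_Ico ht.1.ne]
    exact ⟨ht.1.le, le_rfl⟩
  refine ge_of_tendsto h2 ?_
  filter_upwards [self_mem_nhdsWithin] with s hs
  rw [slope_def_field]
  apply div_nonneg_of_nonpos
  · linarith [h s ⟨hs.1, hs.2.le.trans ht.2⟩]
  · linarith [hs.2]

/-- Weak maximum principle for finitely many functions of time, in barrier form. -/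
theorem le_mul_exp_of_touching {lo hi : ℤ} {a b K κ : ℝ} {P : ℤ → ℝ} {y y' : ℤ → ℝ → ℝ}
    (hP : ∀ i, 0 < P i) (hK : 0 ≤ K)
    (hc : ∀ i, lo ≤ i → i ≤ hi → ContinuousOn (y i) (Icc a b))
    (hd : ∀ i, lo < i → i < hi → ∀ t ∈ Ioc a b, HasDerivWithinAt (y i) (y' i t) (Icc a b) t)
    (hinit : ∀ i, lo ≤ i → i ≤ hi → y i a ≤ K * P i)
    (hbd : ∀ i, i = lo ∨ i = hi → ∀ t ∈ Icc a b, y i t ≤ K * Real.exp (κ * (t - a)) * P i)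
    (htouch : ∀ i, lo < i → i < hi → ∀ t ∈ Ioc a b, ∀ Y > 0, y i t = Y * P i →
      (∀ j, lo ≤ j → j ≤ hi → y j t ≤ Y * P j) → y' i t < κ * Y * P i)
    {i : ℤ} (hlo : lo ≤ i) (hhi : i ≤ hi) {t : ℝ} (ht : t ∈ Icc a b) :
    y i t ≤ K * Real.exp (κ * (t - a)) * P i := by
  set g : ℤ → ℝ → ℝ := fun i t => y i t * Real.exp (-(κ * (t - a))) / P i with hg
  have hyg : ∀ i t, y i t = g i t * Real.exp (κ * (t - a)) * P i := by
    intro i t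
    simp only [hg]
    rw [div_mul_eq_mul_div, div_mul_cancel₀ _ (hP i).ne', mul_assoc, ← Real.exp_add]
    simp
  have hgc : ∀ i, lo ≤ i → i ≤ hi → ContinuousOn (g i) (Icc a b) := fun i h1 h2 =>
    ((hc i h1 h2).mul (by fun_prop)).div_const _
  have hne : (Icc a b).Nonempty := ⟨t, ht⟩
  have hmax : ∀ i, ∃ s ∈ Icc a b, lo ≤ i → i ≤ hi → ∀ r ∈ Icc a b, g i r ≤ g i s := by
    intro i
    by_cases hi' : lo ≤ i ∧ i ≤ hi
    · obtain ⟨s, hs, hm⟩ := isCompact_Icc.exists_isMaxOn hne (hgc i hi'.1 hi'.2)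
      exact ⟨s, hs, fun _ _ r hr => hm hr⟩
    · exact ⟨t, ht, fun h1 h2 => absurd ⟨h1, h2⟩ hi'⟩
  choose s hs hsm using hmax
  obtain ⟨k, hk, hkm⟩ := (Finset.Icc lo hi).exists_max_image (fun i => g i (s i))
    ⟨i, Finset.mem_Icc.2 ⟨hlo, hhi⟩⟩
  rw [Finset.mem_Icc] at hk
  have hall : ∀ j, lo ≤ j → j ≤ hi → ∀ r ∈ Icc a b, g j r ≤ g k (s k) := fun j h1 h2 r hr =>
    (hsm j h1 h2 r hr).trans (hkm j (Finset.mem_Icc.2 ⟨h1, h2⟩))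
  suffices hG : g k (s k) ≤ K by
    rw [hyg]
    have := hP i
    have := (hall i hlo hhi t ht).trans hG
    gcongr
  by_contra! hcon
  set r := s k with hr
  set Y := g k r * Real.exp (κ * (r - a)) with hY
  have hYpos : 0 < Y := mul_pos (by linarith) (Real.exp_pos _)
  have hra : a < r := by
    rcases eq_or_lt_of_le (hs k).1 with h1 | h1
    · exfalso
      have h2 := hinit k hk.1 hk.2
      rw [hyg, h1, ← hr] at h2
      simp only [sub_self, mul_zero, Real.exp_zero, mul_one] at h2
      exact absurd (le_of_mul_le_mul_right h2 (hP k)) (by linarith)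
    · exact h1
  have hnb : ¬(k = lo ∨ k = hi) := by
    intro h1
    have h2 := hbd k h1 r (hs k)
    rw [hyg] at h2
    have h3 := le_of_mul_le_mul_right (le_of_mul_le_mul_right h2 (hP k)) (Real.exp_pos _)
    linarith
  push Not at hnb
  have hklo : lo < k := lt_of_le_of_ne hk.1 (Ne.symm hnb.1)
  have hkhi : k < hi := lt_of_le_of_ne hk.2 hnb.2
  have hrI : r ∈ Ioc a b := ⟨hra, (hs k).2⟩
  have h1 := htouch k hklo hkhi r hrI Y hYpos (hyg k r) (by
    intro j h1 h2
    rw [hyg j r]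
    have := hall j h1 h2 r (hs k)
    have := hP j
    simp only [hY]
    gcongr)
  have h2 : HasDerivWithinAt (g k) ((y' k r - κ * y k r) * Real.exp (-(κ * (r - a))) / P k)
      (Icc a b) r := by
    have e1 : HasDerivAt (fun t => Real.exp (-(κ * (t - a))))
        (Real.exp (-(κ * (r - a))) * (-(κ * 1))) r :=
      ((((hasDerivAt_id r).sub_const a).const_mul κ).neg).exp
    exact (((hd k hklo hkhi r hrI).mul e1.hasDerivWithinAt).div_const (P k)).congr_deriv (by ring)
  have h3 := h2.nonneg_of_forall_le_left hrI (fun q hq => hall k hk.1 hk.2 q hq)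
  have h4 : (y' k r - κ * y k r) * Real.exp (-(κ * (r - a))) / P k < 0 := by
    apply div_neg_of_neg_of_pos _ (hP k)
    apply mul_neg_of_neg_of_pos _ (Real.exp_pos _)
    rw [hyg k r, ← hY]
    linarith
  linarith

/-- Comparison principle for a semidiscrete parabolic inequality. -/
theorem le_mul_exp_of_subsolution {lo hi : ℤ} {a b K κ : ℝ} {P c e : ℤ → ℝ} {y y' : ℤ → ℝ → ℝ}
    (hP : ∀ i, 0 < P i) (hK : 0 ≤ K) (hc0 : ∀ i, 0 ≤ c i)
    (hsuper : ∀ i, lo < i → i < hi →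
      c i * (P (i + 1) + P (i - 1) - 2 * P i) + e i * P i < κ * P i)
    (hc : ∀ i, lo ≤ i → i ≤ hi → ContinuousOn (y i) (Icc a b))
    (hd : ∀ i, lo < i → i < hi → ∀ t ∈ Ioc a b, HasDerivWithinAt (y i) (y' i t) (Icc a b) t)
    (hinit : ∀ i, lo ≤ i → i ≤ hi → y i a ≤ K * P i)
    (hbd : ∀ i, i = lo ∨ i = hi → ∀ t ∈ Icc a b, y i t ≤ K * Real.exp (κ * (t - a)) * P i)
    (hsub : ∀ i, lo < i → i < hi → ∀ t ∈ Ioc a b, 0 < y i t →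
      y' i t ≤ c i * (y (i + 1) t + y (i - 1) t - 2 * y i t) + e i * y i t)
    {i : ℤ} (hlo : lo ≤ i) (hhi : i ≤ hi) {t : ℝ} (ht : t ∈ Icc a b) :
    y i t ≤ K * Real.exp (κ * (t - a)) * P i := by
  refine le_mul_exp_of_touching hP hK hc hd hinit hbd ?_ hlo hhi ht
  intro i h1 h2 t ht Y hY heq hle
  have h3 := hsub i h1 h2 t ht (by rw [heq]; exact mul_pos hY (hP i))
  have h4 := hle (i + 1) (by omega) (by omega)
  have h5 := hle (i - 1) (by omega) (by omega)
  calc y' i t ≤ c i * (y (i + 1) t + y (i - 1) t - 2 * y i t) + e i * y i t := h3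
    _ ≤ c i * (Y * P (i + 1) + Y * P (i - 1) - 2 * (Y * P i)) + e i * (Y * P i) := by
      rw [heq]
      have := hc0 i
      gcongr
    _ = Y * (c i * (P (i + 1) + P (i - 1) - 2 * P i) + e i * P i) := by ring
    _ < Y * (κ * P i) := by gcongr; exact hsuper i h1 h2
    _ = κ * Y * P i := by ring

theorem exists_hasDerivWithinAt_of_bounded_lipschitz {ι : Type*} [Fintype ι] {T K L : ℝ}
    (hT : -1 ≤ T) (hK : 0 ≤ K) (hL : 0 ≤ L) {f : ℝ → (ι → ℝ) → ι → ℝ}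
    (hLip : ∀ t ∈ Icc (-1) T, ∀ v w i, |f t v i - f t w i| ≤ K * dist v w)
    (hcont : ∀ v i, Continuous fun t => f t v i)
    (hbd : ∀ t ∈ Icc (-1) T, ∀ v i, |f t v i| ≤ L) :
    ∃ v : ℝ → ι → ℝ, v (-1) = 0 ∧
      ∀ t ∈ Icc (-1) T, ∀ i, HasDerivWithinAt (fun s => v s i) (f t (v t) i) (Icc (-1) T) t := by
  have hPL : IsPicardLindelof f (⟨-1, left_mem_Icc.2 hT⟩ : Icc (-1 : ℝ) T) (0 : ι → ℝ)
      (⟨L * (T + 1), by apply mul_nonneg <;> linarith⟩) 0 ⟨L, hL⟩ ⟨K, hK⟩ := by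
    constructor
    · intro t ht
      refine LipschitzOnWith.of_dist_le_mul fun v _ w _ => ?_
      refine (dist_pi_le_iff (by positivity)).2 fun i => ?_
      rw [Real.dist_eq]
      exact hLip t ht v w i
    · intro v _
      exact (continuous_pi fun i => hcont v i).continuousOn
    · intro t ht v _
      exact (pi_norm_le_iff_of_nonneg hL).2 fun i => hbd t ht v i
    · simp only [sub_self, NNReal.coe_zero, sub_zero]
      rw [max_eq_left (by linarith)]
      exact (show L * (T - -1) = L * (T + 1) by ring).le
  obtain ⟨v, h0, hv⟩ := hPL.exists_eq_forall_mem_Icc_hasDerivWithinAt₀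
  exact ⟨v, h0, fun t ht i => hasDerivWithinAt_pi.1 (hv t ht) i⟩

/-- Standing assumptions on the coefficients. -/
structure IsAdmissible (p m C a b : ℝ) (A α β : ℝ → ℝ) : Prop where
  one_lt : 1 < p
  le_two : p ≤ 2
  lt_m : 1 + p < m
  contA : Continuous A
  contα : Continuous α
  contβ : Continuous β
  C_pos : 0 < C
  posA : ∀ x, 0 < A x
  lower : ∀ x, C * (1 + |x|) ^ m ≤ A x
  posα : ∀ x, 0 < α x
  leα : ∀ x, α x ≤ a
  nonnegβ : ∀ x, 0 ≤ β x
  leβ : ∀ x, β x ≤ b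

/-- `κ` is a growth rate for which `softAbs` is a strict supersolution on every grid. -/
def IsSuperRate (A β : ℝ → ℝ) (κ : ℝ) : Prop :=
  0 ≤ κ ∧ ∀ n : ℕ, 1 ≤ n → ∀ i : ℤ,
    A (i / n) * n ^ 2 *
      (softAbs ((i + 1 : ℤ) / n) + softAbs ((i - 1 : ℤ) / n) - 2 * softAbs (i / n))
      + β (i / n) * softAbs (i / n) < κ * softAbs (i / n)

theorem IsAdmissible.exists_isSuperRate {p m C a b : ℝ} {A α β : ℝ → ℝ}
    (H : IsAdmissible p m C a b A α β) : ∃ κ, IsSuperRate A β κ := by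
  obtain ⟨S, hS⟩ := (isCompact_Icc (a := (-2 : ℝ)) (b := 2)).bddAbove_image H.contA.continuousOn
  have hS' : ∀ x, |x| ≤ 2 → A x ≤ S := fun x hx => hS ⟨x, abs_le.1 hx, rfl⟩
  have hS0 : 0 < S := (H.posA 0).trans_le (hS' 0 (by norm_num))
  have hb : 0 ≤ b := (H.nonnegβ 0).trans (H.leβ 0)
  refine ⟨2 * S + b + 1, by linarith, fun n hn i => ?_⟩
  have hn0 : (1 : ℝ) ≤ n := by exact_mod_cast hn
  have hψ := half_le_softAbs (i / n)
  have e1 : ((i + 1 : ℤ) : ℝ) / n = i / n + 1 / n := by push_cast; ring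
  have e2 : ((i - 1 : ℤ) : ℝ) / n = i / n - 1 / n := by push_cast; ring
  rw [e1, e2]
  have h1 : A (i / n) * n ^ 2 *
      (softAbs (i / n + 1 / n) + softAbs (i / n - 1 / n) - 2 * softAbs (i / n)) ≤ S := by
    rcases le_or_gt 2 |(i / n : ℝ)| with h | h
    · rw [softAbs_add_add_softAbs_sub_eq _ h]
      · simpa using hS0.le
      · rw [abs_of_nonneg (by positivity), div_le_one (by linarith)]; exact hn0
    · have h2 := softAbs_add_add_softAbs_sub_le (i / n) (1 / n)
      calc _ ≤ A (i / n) * n ^ 2 * (1 / n) ^ 2 := by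
            have := H.posA (i / n)
            gcongr
        _ = A (i / n) := by field_simp
        _ ≤ S := hS' _ h.le
  have h2 := H.leβ (i / n)
  have h3 : β (i / n) * softAbs (i / n) ≤ b * softAbs (i / n) := by
    have := softAbs_pos (i / n)
    gcongr
  nlinarith

/-- Solutions of the semidiscretisation on the grid `ℤ / n`, `|i| ≤ n²`, of the equation
`u_t = A u_xx + β u - α u ^ p`, driven by the boundary values `n t₊²`. -/
structure IsGridSol (p : ℝ) (A α β : ℝ → ℝ) (n : ℕ) (U : ℤ → ℝ → ℝ) : Prop where
  zero : ∀ (i : ℤ) (t : ℝ), t ≤ 0 → U i t = 0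
  hasDerivAt : ∀ (i : ℤ) (t : ℝ), |i| < (n : ℤ) ^ 2 → t < n → HasDerivAt (U i)
    (A (i / n) * n ^ 2 * (U (i + 1) t + U (i - 1) t - 2 * U i t) + β (i / n) * U i t
      - α (i / n) * U i t ^ p) t
  bdry : ∀ (i : ℤ) (t : ℝ), |i| = (n : ℤ) ^ 2 → t < n → U i t = n * (max t 0) ^ 2
  nonneg : ∀ (i : ℤ) (t : ℝ), |i| ≤ (n : ℤ) ^ 2 → t < n → 0 ≤ U i t

theorem softAbs_bdry {n : ℕ} (hn : 1 ≤ n) {i : ℤ} (hi : |i| = (n : ℤ) ^ 2) :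
    softAbs (i / n) = n := by
  have hn0 : (1 : ℝ) ≤ n := by exact_mod_cast hn
  have h1 : |(i : ℝ)| = (n : ℝ) ^ 2 := by exact_mod_cast hi
  have h2 : |(i / n : ℝ)| = n := by
    rw [abs_div, h1, abs_of_nonneg (by linarith : (0 : ℝ) ≤ n)]; field_simp
  rw [softAbs_of_one_le (by rw [h2]; exact hn0), h2]

theorem abs_clamp_sub_clamp_le (M x y : ℝ) :
    |max 0 (min x M) - max 0 (min y M)| ≤ |x - y| := by
  have h1 := abs_max_sub_max_le_abs (min x M) (min y M) 0
  have h2 := abs_min_sub_min_le_max x M y M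
  rw [sub_self, abs_zero, max_eq_left (abs_nonneg _)] at h2
  rw [max_comm 0, max_comm 0]
  exact h1.trans h2

theorem abs_react_sub_le {p c e g a b a' b' x y L M d : ℝ} (hp : 1 ≤ p) (hc : 0 ≤ c) (he : 0 ≤ e)
    (hg : 0 ≤ g) (hL : L = p * M ^ (p - 1)) (hx0 : 0 ≤ x) (hxM : x ≤ M) (hy0 : 0 ≤ y) (hyM : y ≤ M)
    (h1 : |a - a'| ≤ d) (h2 : |b - b'| ≤ d) (h3 : |x - y| ≤ d) :
    |(c * (a + b - 2 * x) + e * x - g * x ^ p) - (c * (a' + b' - 2 * y) + e * y - g * y ^ p)|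
      ≤ (4 * c + e + g * L) * d := by
  have h4 := abs_rpow_sub_rpow_le hp hx0 hy0 hxM hyM
  have hL0 : 0 ≤ L := by
    rw [hL]; have := Real.rpow_nonneg (hx0.trans hxM) (p - 1); positivity
  rw [← hL] at h4
  have h5 : |x ^ p - y ^ p| ≤ L * d := h4.trans (by gcongr)
  obtain ⟨a1, a2⟩ := abs_le.1 h1
  obtain ⟨b1, b2⟩ := abs_le.1 h2
  obtain ⟨c1, c2⟩ := abs_le.1 h3
  obtain ⟨d1, d2⟩ := abs_le.1 h5
  have k1 := mul_le_mul_of_nonneg_left (show (a + b - 2 * x) - (a' + b' - 2 * y) ≤ 4 * d by linarith) hc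
  have k2 := mul_le_mul_of_nonneg_left (show -(4 * d) ≤ (a + b - 2 * x) - (a' + b' - 2 * y) by linarith) hc
  have k3 := mul_le_mul_of_nonneg_left c1 he
  have k4 := mul_le_mul_of_nonneg_left c2 he
  have k5 := mul_le_mul_of_nonneg_left d1 hg
  have k6 := mul_le_mul_of_nonneg_left d2 hg
  rw [abs_le]
  constructor <;> linarith

theorem IsAdmissible.exists_isGridSol {p m C a b : ℝ} {A α β : ℝ → ℝ}
    (H : IsAdmissible p m C a b A α β) {n : ℕ} (hn : 1 ≤ n) :
    ∃ U, IsGridSol p A α β n U := by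
  obtain ⟨κ, hκ0, hκ⟩ := H.exists_isSuperRate
  have hp1 := H.one_lt
  have hp0 : p ≠ 0 := by linarith
  have hn0 : (1 : ℝ) ≤ n := by exact_mod_cast hn
  set T : ℝ := (n : ℝ) with hT
  set N : ℤ := (n : ℤ) ^ 2 with hN
  have hN0 : 0 < N := by positivity
  set P : ℤ → ℝ := fun i => softAbs (i / T) with hPdef
  have hP : ∀ i, 0 < P i := fun i => softAbs_pos _
  set M : ℝ := T ^ 2 * Real.exp (κ * (T + 1)) with hM
  have hMpos : 0 < M := by positivity
  have hTM : T ^ 2 ≤ M := by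
    have : 1 ≤ Real.exp (κ * (T + 1)) := Real.one_le_exp (by positivity)
    nlinarith [sq_nonneg T]
  set G : ℝ → ℝ := fun t => T * (max t 0) ^ 2 with hG
  have hGc : Continuous G := by fun_prop
  have hG0 : ∀ t, 0 ≤ G t := fun t => by positivity
  have hGT : ∀ t ≤ T, G t ≤ T ^ 2 * T := by
    intro t ht
    have h1 : max t 0 ≤ T := max_le ht (by linarith)
    have h2 : 0 ≤ max t 0 := le_max_right _ _
    simp only [hG]
    rw [mul_comm]
    gcongr
  have hPb : ∀ i, |i| = N → P i = T := fun i hi => softAbs_bdry hn hi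
  set S := Finset.Ioo (-N) N with hS
  have hSm : ∀ i, i ∈ S ↔ |i| < N := fun i => by rw [hS, Finset.mem_Ioo, abs_lt]
  -- the extension of a state to all grid points, with and without truncation
  set cl : ℝ → (S → ℝ) → ℤ → ℝ := fun t v i =>
    if h : i ∈ S then max 0 (min (v ⟨i, h⟩) (M * P i)) else G t with hcl
  have hcl0 : ∀ t v i, 0 ≤ cl t v i := by
    intro t v i
    simp only [hcl]
    split_ifs
    · exact le_max_left _ _
    · exact hG0 t
  have hclM : ∀ t v i, i ∈ S → cl t v i ≤ M * P i := by
    intro t v i hi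
    simp only [hcl, dif_pos hi]
    exact max_le (mul_nonneg hMpos.le (hP i).le) (min_le_right _ _)
  have hclM' : ∀ t ≤ T, ∀ v i, cl t v i ≤ M * P i + T ^ 2 * T := by
    intro t ht v i
    by_cases hi : i ∈ S
    · have := hclM t v i hi
      have : 0 ≤ T ^ 2 * T := by positivity
      linarith
    · simp only [hcl, dif_neg hi]
      have := hGT t ht
      have := mul_pos hMpos (hP i)
      linarith
  have hcld : ∀ t v w i, |cl t v i - cl t w i| ≤ dist v w := by
    intro t v w i
    by_cases hi : i ∈ S
    · simp only [hcl, dif_pos hi]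
      refine (abs_clamp_sub_clamp_le _ _ _).trans ?_
      rw [← Real.dist_eq]
      exact dist_le_pi_dist v w ⟨i, hi⟩
    · simp only [hcl, dif_neg hi, sub_self, abs_zero]
      exact dist_nonneg
  set f : ℝ → (S → ℝ) → S → ℝ := fun t v i =>
    A ((i : ℤ) / T) * T ^ 2 * (cl t v (i + 1) + cl t v (i - 1) - 2 * cl t v i)
      + β ((i : ℤ) / T) * cl t v i - α ((i : ℤ) / T) * cl t v i ^ p with hf
  have hAn : ∀ i : ℤ, 0 ≤ A (i / T) * T ^ 2 := fun i => by have := H.posA (i / T); positivity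
  set K : S → ℝ := fun i => 4 * (A ((i : ℤ) / T) * T ^ 2) + β ((i : ℤ) / T)
    + α ((i : ℤ) / T) * (p * (M * P i) ^ (p - 1)) with hK
  have hK0 : ∀ i, 0 ≤ K i := fun i => by
    have := hAn i
    have := H.nonnegβ ((i : ℤ) / T)
    have := (H.posα ((i : ℤ) / T)).le
    have := Real.rpow_nonneg (mul_nonneg hMpos.le (hP i).le) (p - 1)
    simp only [hK]
    positivity
  have hfLip : ∀ t v w i, |f t v i - f t w i| ≤ K i * dist v w := by
    intro t v w i
    exact abs_react_sub_le hp1.le (hAn i) (H.nonnegβ _) (H.posα _).le rfl (hcl0 _ _ _)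
      (hclM _ _ _ i.2) (hcl0 _ _ _) (hclM _ _ _ i.2) (hcld _ _ _ _) (hcld _ _ _ _) (hcld _ _ _ _)
  have hfc : ∀ v i, Continuous fun t => f t v i := by
    intro v i
    have hc : ∀ j, Continuous fun t => cl t v j := by
      intro j
      by_cases hj : j ∈ S
      · simp only [hcl, dif_pos hj]; exact continuous_const
      · simp only [hcl, dif_neg hj]; exact hGc
    have h1 := hc (i + 1)
    have h2 := hc (i - 1)
    have h3 := hc i
    have h4 : Continuous fun t => cl t v i ^ p := h3.rpow_const fun _ => Or.inr (by linarith)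
    simp only [hf]
    fun_prop
  set D : S → ℝ := fun i => M * P (i + 1) + M * P (i - 1) + M * P i + T ^ 2 * T with hD
  have hMP : ∀ i, 0 ≤ M * P i := fun i => (mul_pos hMpos (hP i)).le
  have hTT : 0 ≤ T ^ 2 * T := by positivity
  have hD0 : ∀ i, 0 ≤ D i := fun i => by
    have := hMP (i + 1); have := hMP (i - 1); have := hMP i
    simp only [hD]; positivity
  have hfb : ∀ t ∈ Icc (-1) T, ∀ v i, |f t v i| ≤ K i * D i := by
    intro t ht v i
    have h1 := hMP (i + 1); have h2 := hMP (i - 1); have h3 := hMP i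
    have hb : ∀ j, |cl t v j - 0| ≤ M * P j + T ^ 2 * T := by
      intro j
      rw [sub_zero, abs_of_nonneg (hcl0 _ _ _)]
      exact hclM' t ht.2 v j
    have := abs_react_sub_le (c := A ((i : ℤ) / T) * T ^ 2) (e := β ((i : ℤ) / T))
      (g := α ((i : ℤ) / T)) (a := cl t v (i + 1)) (b := cl t v (i - 1)) (x := cl t v i)
      (a' := 0) (b' := 0) (y := 0) (d := D i) hp1.le (hAn i) (H.nonnegβ _) (H.posα _).le rfl
      (hcl0 _ _ _) (hclM _ _ _ i.2) le_rfl (hMP i) ((hb _).trans (by simp only [hD]; linarith))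
      ((hb _).trans (by simp only [hD]; linarith)) ((hb _).trans (by simp only [hD]; linarith))
    simpa [Real.zero_rpow hp0] using this
  obtain ⟨v, hv0, hv⟩ := exists_hasDerivWithinAt_of_bounded_lipschitz (T := T) (K := ∑ i, K i)
    (L := ∑ i, K i * D i) (f := f) (by linarith) (Finset.sum_nonneg fun i _ => hK0 i)
    (Finset.sum_nonneg fun i _ => mul_nonneg (hK0 i) (hD0 i))
    (fun t _ v w i => (hfLip t v w i).trans (mul_le_mul_of_nonneg_right
      (Finset.single_le_sum (fun j _ => hK0 j) (Finset.mem_univ i)) dist_nonneg)) hfc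
    (fun t ht v i => (hfb t ht v i).trans
      (Finset.single_le_sum (f := fun i => K i * D i)
        (fun j _ => mul_nonneg (hK0 j) (hD0 j)) (Finset.mem_univ i)))
  set y : ℤ → ℝ → ℝ := fun i t => if h : i ∈ S then v t ⟨i, h⟩ else G t with hy
  set cy : ℤ → ℝ → ℝ := fun i t => if i ∈ S then max 0 (min (y i t) (M * P i)) else G t with hcy
  have hclcy : ∀ t i, cl t (v t) i = cy i t := by
    intro t i
    by_cases hi : i ∈ S <;> simp [hcl, hcy, hy, hi]
  have hyG : ∀ i t, |i| = N → y i t = G t := by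
    intro i t hi
    have : i ∉ S := by rw [hSm, hi]; exact lt_irrefl _
    simp [hy, this]
  have hcyG : ∀ i t, |i| = N → cy i t = G t := by
    intro i t hi
    have : i ∉ S := by rw [hSm, hi]; exact lt_irrefl _
    simp [hcy, this]
  have hcyS : ∀ i t, |i| < N → cy i t = max 0 (min (y i t) (M * P i)) := by
    intro i t hi
    simp [hcy, (hSm i).2 hi]
  have hcy0 : ∀ i t, 0 ≤ cy i t := fun i t => by rw [← hclcy]; exact hcl0 _ _ _
  set y' : ℤ → ℝ → ℝ := fun i t =>
    A (i / T) * T ^ 2 * (cy (i + 1) t + cy (i - 1) t - 2 * cy i t)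
      + β (i / T) * cy i t - α (i / T) * cy i t ^ p with hy'
  have hyd : ∀ i, |i| < N → ∀ t ∈ Icc (-1) T, HasDerivWithinAt (y i) (y' i t) (Icc (-1) T) t := by
    intro i hi t ht
    have hiS := (hSm i).2 hi
    have h1 := hv t ht ⟨i, hiS⟩
    simp only [hf, hclcy] at h1
    have h2 : y i = fun s => v s ⟨i, hiS⟩ := by funext s; simp [hy, hiS]
    rw [h2]
    exact h1
  have hbdN : ∀ i, i = -N ∨ i = N → |i| = N := by
    rintro i (rfl | rfl) <;> simp [hN0.le]
  have hyc : ∀ i, |i| ≤ N → ContinuousOn (y i) (Icc (-1) T) := by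
    intro i hi
    rcases lt_or_eq_of_le hi with h | h
    · exact fun t ht => (hyd i h t ht).continuousWithinAt
    · have : y i = G := funext fun t => hyG i t h
      rw [this]; exact hGc.continuousOn
  have hyinit : ∀ i, |i| ≤ N → y i (-1) = 0 := by
    intro i hi
    rcases lt_or_eq_of_le hi with h | h
    · simp [hy, (hSm i).2 h, hv0]
    · rw [hyG i _ h]; simp [hG]
  have habs : ∀ i, -N < i → i < N → |i| < N := fun i h1 h2 => abs_lt.2 ⟨h1, h2⟩
  have hyn : ∀ i, |i| ≤ N → ∀ t ∈ Icc (-1) T, 0 ≤ y i t := by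
    intro i hi t ht
    have h := le_mul_exp_of_touching (lo := -N) (hi := N) (a := -1) (b := T) (K := 0) (κ := 1)
      (P := fun _ => 1) (y := fun i t => -y i t) (y' := fun i t => -y' i t)
      (fun _ => one_pos) le_rfl (fun i h1 h2 => (hyc i (abs_le.2 ⟨h1, h2⟩)).neg)
      (fun i h1 h2 t ht => (hyd i (habs i h1 h2) t (Ioc_subset_Icc_self ht)).neg)
      (fun i h1 h2 => by simp [hyinit i (abs_le.2 ⟨h1, h2⟩)])
      (fun i h1 t _ => by simpa [hyG i t (hbdN i h1)] using hG0 t)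
      (fun i h1 h2 t ht Y hY heq _ => by
        have h3 : y i t ≤ 0 := by linarith
        have h4 : cy i t = 0 := by
          rw [hcyS i t (habs i h1 h2)]
          exact max_eq_left ((min_le_left _ _).trans h3)
        have h5 : 0 ≤ y' i t := by
          simp only [hy', h4, Real.zero_rpow hp0]
          have := hAn i
          have := hcy0 (i + 1) t
          have := hcy0 (i - 1) t
          simp only [mul_zero, sub_zero, add_zero]
          positivity
        linarith) (abs_le.1 hi).1 (abs_le.1 hi).2 ht
    simpa using h
  have htouch : ∀ i, -N < i → i < N → ∀ t ≤ T, ∀ Y > 0, y i t = Y * P i →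
      (∀ j, -N ≤ j → j ≤ N → y j t ≤ Y * P j) → y' i t < κ * Y * P i := by
    intro i h1 h2 t ht Y hY heq hle
    set Y' := min Y M with hY'
    have hY'pos : 0 < Y' := lt_min hY hMpos
    have hmul : ∀ j, min (Y * P j) (M * P j) = Y' * P j := fun j =>
      (min_mul_of_nonneg Y M (hP j).le).symm
    have hci : cy i t = Y' * P i := by
      rw [hcyS i t (habs i h1 h2), heq, hmul, max_eq_right (mul_pos hY'pos (hP i)).le]
    have hcj : ∀ j, -N ≤ j → j ≤ N → cy j t ≤ Y' * P j := by
      intro j j1 j2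
      rcases lt_or_eq_of_le (abs_le.2 ⟨j1, j2⟩ : |j| ≤ N) with h | h
      · rw [hcyS j t h, ← hmul]
        exact max_le (by rw [hmul]; exact (mul_pos hY'pos (hP j)).le)
          (min_le_min_right _ (hle j j1 j2))
      · rw [hcyG j t h, ← hmul]
        refine le_min ?_ ?_
        · rw [← hyG j t h]; exact hle j j1 j2
        · rw [hPb j h]
          refine (hGT t ht).trans ?_
          gcongr
    have h3 := hcj (i + 1) (by omega) (by omega)
    have h4 := hcj (i - 1) (by omega) (by omega)
    have h5 := hAn i
    have h6 : 0 ≤ α (i / T) * cy i t ^ p :=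
      mul_nonneg (H.posα _).le (Real.rpow_nonneg (hcy0 _ _) _)
    calc y' i t ≤ A (i / T) * T ^ 2 * (cy (i + 1) t + cy (i - 1) t - 2 * cy i t)
          + β (i / T) * cy i t := by simp only [hy']; linarith
      _ ≤ A (i / T) * T ^ 2 * (Y' * P (i + 1) + Y' * P (i - 1) - 2 * (Y' * P i))
          + β (i / T) * (Y' * P i) := by rw [hci]; gcongr
      _ = Y' * (A (i / T) * T ^ 2 * (P (i + 1) + P (i - 1) - 2 * P i) + β (i / T) * P i) := by ring
      _ < Y' * (κ * P i) := by gcongr; exact hκ n hn i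
      _ ≤ Y * (κ * P i) := by
        have := hP i
        have : Y' ≤ Y := min_le_left _ _
        gcongr
      _ = κ * Y * P i := by ring
  have hyM : ∀ i, |i| ≤ N → ∀ t ∈ Icc (-1) T, y i t ≤ M * P i := by
    intro i hi t ht
    have hT2 : 0 ≤ T ^ 2 := by positivity
    have hexp : ∀ t, -1 ≤ t → 1 ≤ Real.exp (κ * (t - -1)) := fun t ht =>
      Real.one_le_exp (mul_nonneg hκ0 (by linarith))
    have h := le_mul_exp_of_touching (lo := -N) (hi := N) (a := -1) (b := T) (K := T ^ 2) (κ := κ)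
      (P := P) (y := y) (y' := y') hP hT2 (fun i h1 h2 => hyc i (abs_le.2 ⟨h1, h2⟩))
      (fun i h1 h2 t ht => hyd i (habs i h1 h2) t (Ioc_subset_Icc_self ht))
      (fun i h1 h2 => by
        rw [hyinit i (abs_le.2 ⟨h1, h2⟩)]; exact mul_nonneg hT2 (hP i).le)
      (fun i h1 t ht => by
        rw [hyG i t (hbdN i h1), hPb i (hbdN i h1)]
        refine (hGT t ht.2).trans ?_
        have := hexp t ht.1
        have : T ^ 2 * 1 ≤ T ^ 2 * Real.exp (κ * (t - -1)) := by gcongr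
        rw [mul_one] at this
        gcongr)
      (fun i h1 h2 t ht => htouch i h1 h2 t ht.2) (abs_le.1 hi).1 (abs_le.1 hi).2 ht
    refine h.trans ?_
    have := hP i
    have : κ * (t - -1) ≤ κ * (T + 1) := by gcongr; linarith [ht.2]
    simp only [hM]
    gcongr
  have hyz : ∀ i, |i| ≤ N → ∀ t ∈ Icc (-1 : ℝ) 0, y i t = 0 := by
    intro i hi t ht
    have hsub : Icc (-1 : ℝ) 0 ⊆ Icc (-1) T := Icc_subset_Icc_right (by linarith)
    have h := le_mul_exp_of_touching (lo := -N) (hi := N) (a := -1) (b := 0) (K := 0) (κ := κ)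
      (P := P) (y := y) (y' := y') hP le_rfl
      (fun i h1 h2 => (hyc i (abs_le.2 ⟨h1, h2⟩)).mono hsub)
      (fun i h1 h2 t ht => (hyd i (habs i h1 h2) t (hsub (Ioc_subset_Icc_self ht))).mono hsub)
      (fun i h1 h2 => by rw [hyinit i (abs_le.2 ⟨h1, h2⟩)]; simp)
      (fun i h1 t ht => by rw [hyG i t (hbdN i h1)]; simp [hG, ht.2])
      (fun i h1 h2 t ht => htouch i h1 h2 t (by linarith [ht.2]))
      (abs_le.1 hi).1 (abs_le.1 hi).2 ht
    rw [zero_mul, zero_mul] at h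
    exact le_antisymm h (hyn i hi t (hsub ht))
  have hcyy : ∀ i, |i| ≤ N → ∀ t ∈ Icc (-1) T, cy i t = y i t := by
    intro i hi t ht
    rcases lt_or_eq_of_le hi with h | h
    · rw [hcyS i t h, min_eq_left (hyM i hi t ht), max_eq_right (hyn i hi t ht)]
    · rw [hcyG i t h, hyG i t h]
  set U : ℤ → ℝ → ℝ := fun i t => if t ≤ 0 then 0 else y i t with hU
  have hUy : ∀ i, |i| ≤ N → ∀ t ∈ Icc (-1) T, U i t = y i t := by
    intro i hi t ht
    simp only [hU]
    split_ifs with h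
    · exact (hyz i hi t ⟨ht.1, h⟩).symm
    · rfl
  refine ⟨U, ⟨fun i t ht => if_pos ht, ?_, ?_, ?_⟩⟩
  · intro i t hi htT
    have hi1 : |i + 1| ≤ N := by rw [abs_le]; rw [abs_lt] at hi; omega
    have hi2 : |i - 1| ≤ N := by rw [abs_le]; rw [abs_lt] at hi; omega
    rcases lt_or_ge (-1) t with h | h
    · have hI : t ∈ Icc (-1) T := ⟨h.le, htT.le⟩
      have hnh : Icc (-1) T ∈ 𝓝 t := Icc_mem_nhds h htT
      have h1 := (hyd i hi t hI).hasDerivAt hnh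
      have h2 : U i =ᶠ[𝓝 t] y i := by
        filter_upwards [hnh] with s hs using hUy i hi.le s hs
      refine (h1.congr_of_eventuallyEq h2).congr_deriv ?_
      simp only [hy']
      rw [hcyy _ hi1 t hI, hcyy _ hi2 t hI, hcyy _ hi.le t hI, hUy _ hi1 t hI, hUy _ hi2 t hI,
        hUy _ hi.le t hI]
    · have h2 : U i =ᶠ[𝓝 t] fun _ => 0 := by
        filter_upwards [Iio_mem_nhds (show t < 0 by linarith)] with s hs
        exact if_pos (le_of_lt hs)
      refine ((hasDerivAt_const t (0 : ℝ)).congr_of_eventuallyEq h2).congr_deriv ?_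
      have : ∀ j, U j t = 0 := fun j => if_pos (by linarith)
      simp [this, Real.zero_rpow hp0]
  · intro i t hi htT
    rcases lt_or_ge (-1) t with h | h
    · rw [hUy i hi.le t ⟨h.le, htT.le⟩, hyG i t hi]
    · simp [hU, show t ≤ 0 by linarith]
  · intro i t hi htT
    rcases lt_or_ge (-1) t with h | h
    · rw [hUy i hi t ⟨h.le, htT.le⟩]; exact hyn i hi t ⟨h.le, htT.le⟩
    · simp [hU, show t ≤ 0 by linarith]

theorem IsSuperRate.le_of_subsolution {A β : ℝ → ℝ} {κ : ℝ} (hκ : IsSuperRate A β κ)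
    (hA : ∀ x, 0 < A x) {n : ℕ} (hn : 1 ≤ n) {T K : ℝ} (hK : 0 ≤ K) {y y' : ℤ → ℝ → ℝ}
    (hc : ∀ i : ℤ, |i| ≤ (n : ℤ) ^ 2 → ContinuousOn (y i) (Icc (-1) T))
    (hd : ∀ i : ℤ, |i| < (n : ℤ) ^ 2 → ∀ t ≤ T, HasDerivAt (y i) (y' i t) t)
    (hinit : ∀ i : ℤ, |i| ≤ (n : ℤ) ^ 2 → y i (-1) ≤ 0)
    (hbd : ∀ i : ℤ, |i| = (n : ℤ) ^ 2 → ∀ t ≤ T, y i t ≤ K * n)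
    (hsub : ∀ i : ℤ, |i| < (n : ℤ) ^ 2 → ∀ t ≤ T, 0 < y i t →
      y' i t ≤ A (i / n) * n ^ 2 * (y (i + 1) t + y (i - 1) t - 2 * y i t) + β (i / n) * y i t)
    {i : ℤ} (hi : |i| ≤ (n : ℤ) ^ 2) {t : ℝ} (ht : t ∈ Icc (-1) T) :
    y i t ≤ K * Real.exp (κ * (T + 1)) * softAbs (i / n) := by
  have hN0 : (0 : ℤ) ≤ (n : ℤ) ^ 2 := by positivity
  have habs : ∀ i : ℤ, -(n : ℤ) ^ 2 < i → i < (n : ℤ) ^ 2 → |i| < (n : ℤ) ^ 2 :=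
    fun i h1 h2 => abs_lt.2 ⟨h1, h2⟩
  have habs' : ∀ i : ℤ, -(n : ℤ) ^ 2 ≤ i → i ≤ (n : ℤ) ^ 2 → |i| ≤ (n : ℤ) ^ 2 :=
    fun i h1 h2 => abs_le.2 ⟨h1, h2⟩
  have h := le_mul_exp_of_subsolution (lo := -(n : ℤ) ^ 2) (hi := (n : ℤ) ^ 2) (a := -1) (b := T)
    (K := K) (κ := κ) (P := fun i => softAbs (i / n)) (c := fun i => A (i / n) * n ^ 2)
    (e := fun i => β (i / n)) (y := y) (y' := y') (fun _ => softAbs_pos _) hK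
    (fun i => by have := hA (i / n); positivity) (fun i _ _ => hκ.2 n hn i)
    (fun i h1 h2 => hc i (habs' i h1 h2))
    (fun i h1 h2 t ht => (hd i (habs i h1 h2) t ht.2).hasDerivWithinAt)
    (fun i h1 h2 => (hinit i (habs' i h1 h2)).trans (mul_nonneg hK (softAbs_pos _).le))
    (fun i h1 t ht => by
      have h2 : |i| = (n : ℤ) ^ 2 := by rcases h1 with rfl | rfl <;> simp
      refine (hbd i h2 t ht.2).trans ?_
      simp only [softAbs_bdry hn h2]
      have : 1 ≤ Real.exp (κ * (t - -1)) :=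
        Real.one_le_exp (mul_nonneg hκ.1 (by linarith [ht.1]))
      have : K * 1 ≤ K * Real.exp (κ * (t - -1)) := by gcongr
      rw [mul_one] at this
      gcongr)
    (fun i h1 h2 t ht hy => hsub i (habs i h1 h2) t ht.2 hy)
    (abs_le.1 hi).1 (abs_le.1 hi).2 ht
  refine h.trans ?_
  have := softAbs_pos (i / n)
  have : κ * (t - -1) ≤ κ * (T + 1) := by
    have := hκ.1
    gcongr; linarith [ht.2]
  gcongr

namespace IsGridSol

variable {p m C a b : ℝ} {A α β : ℝ → ℝ} {n : ℕ} {U : ℤ → ℝ → ℝ}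

theorem continuousAt (hU : IsGridSol p A α β n U) {i : ℤ} (hi : |i| ≤ (n : ℤ) ^ 2) {t : ℝ}
    (ht : t < n) : ContinuousAt (U i) t := by
  rcases lt_or_eq_of_le hi with h | h
  · exact (hU.hasDerivAt i t h ht).continuousAt
  · have h1 : U i =ᶠ[𝓝 t] fun s => n * (max s 0) ^ 2 := by
      filter_upwards [Iio_mem_nhds ht] with s hs using hU.bdry i s h hs
    exact ContinuousAt.congr (by fun_prop) h1.symm

theorem continuousOn_sub (hU : IsGridSol p A α β n U) {i : ℤ} (hi : |i| ≤ (n : ℤ) ^ 2) {T τ : ℝ}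
    (hT : T < n) (hτ : 0 ≤ τ) : ContinuousOn (fun t => U i (t - τ)) (Icc (-1) T) := fun t ht =>
  ((hU.continuousAt hi (show t - τ < n by linarith [ht.2])).comp
    (f := fun t => t - τ) (by fun_prop)).continuousWithinAt

theorem monotone (hU : IsGridSol p A α β n U) (H : IsAdmissible p m C a b A α β)
    (hn : 1 ≤ n) {i : ℤ} (hi : |i| ≤ (n : ℤ) ^ 2) {s t : ℝ} (hst : s ≤ t) (ht : t < n) :
    U i s ≤ U i t := by
  obtain ⟨κ, hκ⟩ := H.exists_isSuperRate
  rcases lt_or_ge t (-1) with h1 | h1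
  · rw [hU.zero i s (by linarith), hU.zero i t (by linarith)]
  set τ := t - s with hτ
  have hτ0 : 0 ≤ τ := by linarith
  have h := hκ.le_of_subsolution H.posA hn (T := t) (K := 0) le_rfl
    (y := fun i t => U i (t - τ) - U i t)
    (fun i hi => (hU.continuousOn_sub hi ht hτ0).sub
      (by simpa using hU.continuousOn_sub hi ht le_rfl))
    (fun i hi r hr => ((hU.hasDerivAt i (r - τ) hi (by linarith)).comp_sub_const r τ).sub
      (hU.hasDerivAt i r hi (by linarith)))
    (fun i _ => by rw [hU.zero i (-1) (by norm_num), hU.zero i (-1 - τ) (by linarith)]; simp)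
    (fun i hi r hr => by
      rw [hU.bdry i r hi (by linarith), hU.bdry i (r - τ) hi (by linarith)]
      have h2 : max (r - τ) 0 ≤ max r 0 := max_le_max_right _ (by linarith)
      have h3 : 0 ≤ max (r - τ) 0 := le_max_right _ _
      have : (n : ℝ) * max (r - τ) 0 ^ 2 ≤ n * max r 0 ^ 2 := by gcongr
      linarith)
    (fun i hi r hr hpos => by
      have h2 : U i r ^ p ≤ U i (r - τ) ^ p := Real.rpow_le_rpow
        (hU.nonneg i r hi.le (by linarith)) (by linarith) (by linarith [H.one_lt])
      have h3 := mul_le_mul_of_nonneg_left h2 (H.posα (i / n)).le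
      linarith) hi (t := t) ⟨h1, le_rfl⟩
  simp only [hτ, sub_sub_cancel, zero_mul] at h
  linarith

theorem sub_le (hU : IsGridSol p A α β n U) (H : IsAdmissible p m C a b A α β) {κ : ℝ}
    (hκ : IsSuperRate A β κ) (hn : 1 ≤ n) {T : ℝ} (hT1 : 1 ≤ T) (hTn : T < n) {i : ℤ}
    (hi : |i| ≤ (n : ℤ) ^ 2) {s t : ℝ} (hst : s ≤ t) (htT : t ≤ T) :
    U i t - U i s ≤ 2 * T * Real.exp (κ * (T + 1)) * softAbs (i / n) * (t - s) := by
  have hψ := softAbs_pos (i / n)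
  set τ := t - s with hτ
  have hτ0 : 0 ≤ τ := by linarith
  rcases lt_or_ge t (-1) with h1 | h1
  · rw [hU.zero i s (by linarith), hU.zero i t (by linarith)]
    rw [sub_self]; positivity
  have h := hκ.le_of_subsolution H.posA hn (T := T) (K := 2 * T * τ) (by positivity)
    (y := fun i t => U i t - U i (t - τ))
    (fun i hi => ContinuousOn.sub (by simpa using hU.continuousOn_sub hi hTn le_rfl)
      (hU.continuousOn_sub hi hTn hτ0))
    (fun i hi r hr => (hU.hasDerivAt i r hi (by linarith)).sub
      ((hU.hasDerivAt i (r - τ) hi (by linarith)).comp_sub_const r τ))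
    (fun i _ => by rw [hU.zero i (-1) (by norm_num), hU.zero i (-1 - τ) (by linarith)]; simp)
    (fun i hi r hr => by
      rw [hU.bdry i r hi (by linarith), hU.bdry i (r - τ) hi (by linarith)]
      have h2 : max r 0 ^ 2 - max (r - τ) 0 ^ 2 ≤ 2 * T * τ := by
        rcases max_cases r 0 with ⟨e1, _⟩ | ⟨e1, _⟩ <;>
          rcases max_cases (r - τ) 0 with ⟨e2, _⟩ | ⟨e2, _⟩ <;> rw [e1, e2] <;> nlinarith
      have h3 := mul_le_mul_of_nonneg_left h2 (Nat.cast_nonneg n : (0 : ℝ) ≤ n)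
      linarith)
    (fun i hi r hr hpos => by
      have h2 : U i (r - τ) ^ p ≤ U i r ^ p := Real.rpow_le_rpow
        (hU.nonneg i _ hi.le (by linarith)) (by linarith) (by linarith [H.one_lt])
      have h3 := mul_le_mul_of_nonneg_left h2 (H.posα (i / n)).le
      linarith) hi (t := t) ⟨h1, htT⟩
  simp only [hτ, sub_sub_cancel] at h
  rw [hτ]
  linarith

theorem mixed_sub_le (hU : IsGridSol p A α β n U) (H : IsAdmissible p m C a b A α β) {κ : ℝ}
    (hκ : IsSuperRate A β κ) (hn : 1 ≤ n) {T : ℝ} (hT1 : 1 ≤ T) (hTn : T < n) {i : ℤ}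
    (hi : |i| ≤ (n : ℤ) ^ 2) {t σ τ : ℝ} (hσ : 0 ≤ σ) (hτ : 0 ≤ τ) (htT : t ≤ T) :
    U i t - U i (t - τ) - U i (t - σ) + U i (t - (σ + τ)) ≤
      2 * T * Real.exp (κ * (T + 1)) * softAbs (i / n) * (σ * τ) := by
  have hψ := softAbs_pos (i / n)
  rcases lt_or_ge t (-1) with h1 | h1
  · rw [hU.zero i _ (by linarith), hU.zero i _ (by linarith), hU.zero i _ (by linarith),
      hU.zero i _ (by linarith)]
    simp only [sub_self, add_zero]; positivity
  have h := hκ.le_of_subsolution H.posA hn (T := T) (K := 2 * (σ * τ)) (by positivity)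
    (y := fun i t => U i t - U i (t - τ) - U i (t - σ) + U i (t - (σ + τ)))
    (fun i hi => (((show ContinuousOn (fun t => U i t) (Icc (-1) T) by
      simpa using hU.continuousOn_sub hi hTn le_rfl).sub
      (hU.continuousOn_sub hi hTn hτ)).sub (hU.continuousOn_sub hi hTn hσ)).add
      (hU.continuousOn_sub hi hTn (add_nonneg hσ hτ)))
    (fun i hi r hr => (((hU.hasDerivAt i r hi (by linarith)).sub
      ((hU.hasDerivAt i (r - τ) hi (by linarith)).comp_sub_const r τ)).sub
      ((hU.hasDerivAt i (r - σ) hi (by linarith)).comp_sub_const r σ)).add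
      ((hU.hasDerivAt i (r - (σ + τ)) hi (by linarith)).comp_sub_const r (σ + τ)))
    (fun i _ => by
      rw [hU.zero i _ (by linarith), hU.zero i _ (by linarith), hU.zero i _ (by linarith),
        hU.zero i _ (by linarith)]
      simp)
    (fun i hi r hr => by
      rw [hU.bdry i r hi (by linarith), hU.bdry i (r - τ) hi (by linarith),
        hU.bdry i (r - σ) hi (by linarith), hU.bdry i (r - (σ + τ)) hi (by linarith)]
      have h2 : max r 0 ^ 2 - max (r - τ) 0 ^ 2 - max (r - σ) 0 ^ 2 + max (r - (σ + τ)) 0 ^ 2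
          ≤ 2 * (σ * τ) := by
        rcases max_cases r 0 with ⟨e1, _⟩ | ⟨e1, _⟩ <;>
          rcases max_cases (r - τ) 0 with ⟨e2, _⟩ | ⟨e2, _⟩ <;>
          rcases max_cases (r - σ) 0 with ⟨e3, _⟩ | ⟨e3, _⟩ <;>
          rcases max_cases (r - (σ + τ)) 0 with ⟨e4, _⟩ | ⟨e4, _⟩ <;> rw [e1, e2, e3, e4] <;>
          nlinarith [mul_nonneg hσ hτ]
      have h3 := mul_le_mul_of_nonneg_left h2 (Nat.cast_nonneg n : (0 : ℝ) ≤ n)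
      linarith)
    (fun i hi r hr hpos => by
      have h2 : U i (r - τ) ^ p + U i (r - σ) ^ p ≤ U i r ^ p + U i (r - (σ + τ)) ^ p :=
        rpow_add_rpow_le_of_add_le H.one_lt.le (hU.nonneg i _ hi.le (by linarith))
          (hU.monotone H hn hi.le (by linarith) (by linarith))
          (hU.monotone H hn hi.le (by linarith) (by linarith)) (by linarith)
      have h3 := mul_le_mul_of_nonneg_left h2 (H.posα (i / n)).le
      linarith) hi (t := t) ⟨h1, htT⟩
  have h2 : 0 ≤ 2 * (σ * τ) * Real.exp (κ * (T + 1)) * softAbs (i / n) := by positivity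
  refine (h.trans (le_mul_of_one_le_left h2 hT1)).trans (le_of_eq ?_)
  ring

end IsGridSol

theorem abs_sub_le_mul_of_forall_step {f : ℤ → ℝ} {c R : ℝ}
    (h : ∀ i : ℤ, |(i : ℝ)| ≤ R → |f (i + 1) - f i| ≤ c) {i j : ℤ} (hi : |(i : ℝ)| ≤ R)
    (hj : |(j : ℝ)| ≤ R) : |f j - f i| ≤ c * |(j : ℝ) - i| := by
  have key : ∀ {i j : ℤ}, i ≤ j → |(i : ℝ)| ≤ R → |(j : ℝ)| ≤ R →
      |f j - f i| ≤ c * |(j : ℝ) - i| := by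
    intro i j hij hi
    induction j, hij using Int.leInduction with
    | base => intro _; simp
    | succ j hij ih =>
      intro hj
      have hij' : (i : ℝ) ≤ j := by exact_mod_cast hij
      have hj' : |(j : ℝ)| ≤ R := by
        rw [abs_le] at hi hj ⊢
        push_cast at hj
        constructor <;> linarith [hi.1, hj.2]
      have h1 := ih hj'
      have h2 := h j hj'
      rw [abs_of_nonneg (show (0 : ℝ) ≤ j - i by linarith)] at h1
      rw [abs_of_nonneg (show (0 : ℝ) ≤ ((j + 1 : ℤ) : ℝ) - i by push_cast; linarith)]
      calc |f (j + 1) - f i| = |(f (j + 1) - f j) + (f j - f i)| := by ring_nf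
        _ ≤ c + c * (j - i) := (abs_add_le _ _).trans (by linarith)
        _ = c * ((j + 1 : ℤ) - i) := by push_cast; ring
  rcases le_total i j with hij | hij
  · exact key hij hi hj
  · rw [abs_sub_comm, abs_sub_comm (j : ℝ)]
    exact key hij hj hi

/-- The value of `u_xx` prescribed by the equation when `u_t = w` and `u = v` at `x`. -/
noncomputable def curvature (p : ℝ) (A α β : ℝ → ℝ) (x w v : ℝ) : ℝ :=
  (w - β x * v + α x * v ^ p) / A x

namespace IsGridSol

variable {p m C a b : ℝ} {A α β : ℝ → ℝ} {n : ℕ} {U : ℤ → ℝ → ℝ}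

theorem hasDerivAt_deriv (hU : IsGridSol p A α β n U) {i : ℤ} (hi : |i| < (n : ℤ) ^ 2) {t : ℝ}
    (ht : t < n) : HasDerivAt (U i) (deriv (U i) t) t :=
  (hU.hasDerivAt i t hi ht).differentiableAt.hasDerivAt

theorem deriv_eq (hU : IsGridSol p A α β n U) {i : ℤ} (hi : |i| < (n : ℤ) ^ 2) {t : ℝ}
    (ht : t < n) : A (i / n) * n ^ 2 * (U (i + 1) t + U (i - 1) t - 2 * U i t)
      = deriv (U i) t - β (i / n) * U i t + α (i / n) * U i t ^ p := by
  rw [(hU.hasDerivAt i t hi ht).deriv]; ring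

theorem deriv_le (hU : IsGridSol p A α β n U) (H : IsAdmissible p m C a b A α β) {κ : ℝ}
    (hκ : IsSuperRate A β κ) (hn : 1 ≤ n) {T : ℝ} (hT1 : 1 ≤ T) (hTn : T < n) {i : ℤ}
    (hi : |i| < (n : ℤ) ^ 2) {t : ℝ} (htT : t ≤ T) :
    deriv (U i) t ≤ 2 * T * Real.exp (κ * (T + 1)) * softAbs (i / n) := by
  refine le_of_tendsto (hU.hasDerivAt_deriv hi (htT.trans_lt hTn)).tendsto_slope_zero_left ?_
  filter_upwards [self_mem_nhdsWithin] with h (hh : h < 0)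
  have h1 := hU.sub_le H hκ hn hT1 hTn hi.le (show t + h ≤ t by linarith) htT
  rw [smul_eq_mul, inv_mul_eq_div, div_le_iff_of_neg hh]
  linarith

theorem deriv_sub_deriv_le (hU : IsGridSol p A α β n U) (H : IsAdmissible p m C a b A α β) {κ : ℝ}
    (hκ : IsSuperRate A β κ) (hn : 1 ≤ n) {T : ℝ} (hT1 : 1 ≤ T) (hTn : T < n) {i : ℤ}
    (hi : |i| < (n : ℤ) ^ 2) {s t : ℝ} (hst : s ≤ t) (htT : t ≤ T) :
    deriv (U i) t - deriv (U i) s ≤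
      2 * T * Real.exp (κ * (T + 1)) * softAbs (i / n) * (t - s) := by
  refine le_of_tendsto
    ((hU.hasDerivAt_deriv hi (htT.trans_lt hTn)).tendsto_slope_zero_left.sub
      (hU.hasDerivAt_deriv hi ((hst.trans htT).trans_lt hTn)).tendsto_slope_zero_left) ?_
  filter_upwards [self_mem_nhdsWithin] with h (hh : h < 0)
  have h1 := hU.mixed_sub_le H hκ hn hT1 hTn hi.le (σ := t - s) (τ := -h) (by linarith)
    (by linarith) htT
  rw [show t - -h = t + h by ring, show t - (t - s) = s by ring,
    show t - (t - s + -h) = s + h by ring] at h1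
  rw [smul_eq_mul, smul_eq_mul, ← mul_sub, inv_mul_eq_div, div_le_iff_of_neg hh]
  linarith

end IsGridSol

/-- Bounds for a grid solution on `|x| ≤ X`, `t ≤ T`, with a constant independent of the grid. -/
structure HasLocalBounds (p : ℝ) (A α β : ℝ → ℝ) (X T L : ℝ) (n : ℕ) (U : ℤ → ℝ → ℝ) : Prop where
  nonneg : ∀ i : ℤ, |(i : ℝ)| ≤ X * n → ∀ t ≤ T, 0 ≤ U i t
  le : ∀ i : ℤ, |(i : ℝ)| ≤ X * n → ∀ t ≤ T, U i t ≤ L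
  mono : ∀ i : ℤ, |(i : ℝ)| ≤ X * n → ∀ s t : ℝ, s ≤ t → t ≤ T → U i s ≤ U i t
  lip_time : ∀ i : ℤ, |(i : ℝ)| ≤ X * n → ∀ s t : ℝ, s ≤ t → t ≤ T → U i t - U i s ≤ L * (t - s)
  concave : ∀ i : ℤ, |(i : ℝ)| ≤ X * n → ConcaveOn ℝ (Iic T) fun t => U i t - L * t ^ 2
  lip_space : ∀ i j : ℤ, |(i : ℝ)| ≤ X * n → |(j : ℝ)| ≤ X * n → ∀ t ≤ T,
    |U j t - U i t| ≤ L / n * |(j : ℝ) - i|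
  lip_mixed : ∀ i j : ℤ, |(i : ℝ)| ≤ X * n → |(j : ℝ)| ≤ X * n → ∀ s t : ℝ, s ≤ t → t ≤ T →
    |(U j t - U j s) - (U i t - U i s)| ≤ L * (t - s) / n * |(j : ℝ) - i|
  secondDiff : ∀ (i : ℤ) (k : ℕ), |(i : ℝ)| + k ≤ X * n → ∀ s t t' r ε : ℝ, s < t' → t' ≤ T →
    t ∈ Icc s t' → 0 ≤ ε →
    (∀ j : ℤ, |j - i| < k →
      |curvature p A α β (j / n) ((U j t' - U j s) / (t' - s)) (U j t) - r| ≤ ε) →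
    |U (i + k) t + U (i - k) t - 2 * U i t - r * (k / n) ^ 2|
      ≤ (ε + L * (t' - s)) * (k / n) ^ 2 + L * (t' - s)

theorem secondDiff_le_of_mul_le {c n C D K : ℝ} (hC : 0 < C) (hc : C ≤ c) (hn : 0 < n) (hK : 0 ≤ K)
    (h : c * n ^ 2 * D ≤ K) : D ≤ K / C / n ^ 2 := by
  have hc0 : 0 < c := by linarith
  have h1 : D ≤ K / (c * n ^ 2) := by rw [le_div_iff₀ (by positivity)]; linarith
  refine h1.trans ?_
  rw [div_div]
  gcongr

set_option maxHeartbeats 2000000 in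
theorem IsAdmissible.exists_hasLocalBounds {p m C a b : ℝ} {A α β : ℝ → ℝ}
    (H : IsAdmissible p m C a b A α β) {X T : ℝ} (hX : 0 ≤ X) (hT1 : 1 ≤ T) :
    ∃ L, 0 ≤ L ∧ ∃ n₀ : ℕ, 1 ≤ n₀ ∧ ∀ n : ℕ, n₀ ≤ n → ∀ U, IsGridSol p A α β n U →
      HasLocalBounds p A α β X T L n U := by
  obtain ⟨κ, hκ⟩ := H.exists_isSuperRate
  have hp1 := H.one_lt
  have hC := H.C_pos
  have ha : 0 ≤ a := (H.posα 0).le.trans (H.leα 0)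
  have hb : 0 ≤ b := (H.nonnegβ 0).trans (H.leβ 0)
  have hAC : ∀ x, C ≤ A x := fun x => by
    have h1 : 1 ≤ (1 + |x|) ^ m :=
      Real.one_le_rpow (by linarith [abs_nonneg x]) (by linarith [H.lt_m])
    have := H.lower x
    nlinarith
  set E : ℝ := 2 * T * Real.exp (κ * (T + 1)) with hE
  have hE0 : 0 ≤ E := by positivity
  set B : ℝ := E * (X + 3) with hB
  have hB0 : 0 ≤ B := by positivity
  set M : ℝ := B * T with hM
  have hM0 : 0 ≤ M := by positivity
  set Q : ℝ := p * M ^ (p - 1) with hQ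
  have hQ0 : 0 ≤ Q := by have := Real.rpow_nonneg hM0 (p - 1); positivity
  have hMp : 0 ≤ M ^ p := Real.rpow_nonneg hM0 p
  set K1 : ℝ := (B + a * M ^ p) / C with hK1
  have hK10 : 0 ≤ K1 := by positivity
  set K3 : ℝ := (B + a * (Q * B)) / C with hK3
  have hK30 : 0 ≤ K3 := by positivity
  set C1 : ℝ := (b + a * Q) * B with hC1
  have hC10 : 0 ≤ C1 := by positivity
  have hC1C : 0 ≤ C1 / C := by positivity
  set L : ℝ := 5 * B + 2 * M + K1 + K3 + C1 / C with hL
  refine ⟨L, by positivity, ⌈X + 2⌉₊ + ⌈T⌉₊ + 1, by omega, fun n hn U hU => ?_⟩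
  have hn1 : 1 ≤ n := by omega
  have hn1' : (1 : ℝ) ≤ n := by exact_mod_cast hn1
  have hn0 : (0 : ℝ) < n := by linarith
  have hnn : (⌈X + 2⌉₊ : ℝ) + ⌈T⌉₊ + 1 ≤ n := by exact_mod_cast hn
  have hXn : X + 2 < n := by
    have := Nat.le_ceil (X + 2); have : (0 : ℝ) ≤ ⌈T⌉₊ := Nat.cast_nonneg _; linarith
  have hTn : T < n := by
    have := Nat.le_ceil T; have : (0 : ℝ) ≤ ⌈X + 2⌉₊ := Nat.cast_nonneg _; linarith
  -- membership in the larger window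
  have hwin : ∀ j : ℤ, |(j : ℝ)| ≤ (X + 2) * n → |j| < (n : ℤ) ^ 2 := by
    intro j hj
    have : |(j : ℝ)| < (n : ℝ) ^ 2 := by nlinarith
    exact_mod_cast this
  have hmem : ∀ (i j : ℤ) (k : ℝ), |(i : ℝ)| + k ≤ (X + 2) * n → |((j - i : ℤ) : ℝ)| ≤ k →
      |(j : ℝ)| ≤ (X + 2) * n := by
    intro i j k h1 h2
    have : (j : ℝ) = i + ((j - i : ℤ) : ℝ) := by push_cast; ring
    rw [this]
    exact (abs_add_le _ _).trans (by linarith)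
  have hψ : ∀ j : ℤ, |(j : ℝ)| ≤ (X + 2) * n → E * softAbs (j / n) ≤ B := by
    intro j hj
    have h1 : |(j / n : ℝ)| ≤ X + 2 := by
      rw [abs_div, abs_of_pos hn0, div_le_iff₀ hn0]; exact hj
    have := softAbs_le (j / n)
    rw [hB]
    gcongr
    linarith
  have hU0 : ∀ j : ℤ, |(j : ℝ)| ≤ (X + 2) * n → ∀ t ≤ T, 0 ≤ U j t := fun j hj t ht =>
    hU.nonneg j t (hwin j hj).le (by linarith)
  have hUmono : ∀ j : ℤ, |(j : ℝ)| ≤ (X + 2) * n → ∀ s t : ℝ, s ≤ t → t ≤ T → U j s ≤ U j t :=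
    fun j hj s t hst ht => hU.monotone H hn1 (hwin j hj).le hst (by linarith)
  have hUlip : ∀ j : ℤ, |(j : ℝ)| ≤ (X + 2) * n → ∀ s t : ℝ, s ≤ t → t ≤ T →
      U j t - U j s ≤ B * (t - s) := by
    intro j hj s t hst ht
    refine (hU.sub_le H hκ hn1 hT1 hTn (hwin j hj).le hst ht).trans ?_
    have := hψ j hj
    have : 0 ≤ t - s := by linarith
    gcongr
  have hUM : ∀ j : ℤ, |(j : ℝ)| ≤ (X + 2) * n → ∀ t ≤ T, U j t ≤ M := by
    intro j hj t ht
    rcases le_total t 0 with h | h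
    · rw [hU.zero j t h]; exact hM0
    · have h1 := hUlip j hj 0 t h ht
      rw [hU.zero j 0 le_rfl] at h1
      rw [hM]
      nlinarith
  have hWB : ∀ j : ℤ, |(j : ℝ)| ≤ (X + 2) * n → ∀ t ≤ T, deriv (U j) t ≤ B := fun j hj t ht =>
    (hU.deriv_le H hκ hn1 hT1 hTn (hwin j hj) ht).trans (hψ j hj)
  have hWd : ∀ j : ℤ, |(j : ℝ)| ≤ (X + 2) * n → ∀ s t : ℝ, s ≤ t → t ≤ T →
      deriv (U j) t - deriv (U j) s ≤ B * (t - s) := by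
    intro j hj s t hst ht
    refine (hU.deriv_sub_deriv_le H hκ hn1 hT1 hTn (hwin j hj) hst ht).trans ?_
    have := hψ j hj
    have : 0 ≤ t - s := by linarith
    gcongr
  have hUd : ∀ j : ℤ, |(j : ℝ)| ≤ (X + 2) * n → ∀ t ≤ T, HasDerivAt (U j) (deriv (U j) t) t :=
    fun j hj t ht => hU.hasDerivAt_deriv (hwin j hj) (by linarith)
  have hUeq : ∀ j : ℤ, |(j : ℝ)| ≤ (X + 2) * n → ∀ t ≤ T,
      A (j / n) * n ^ 2 * (U (j + 1) t + U (j - 1) t - 2 * U j t)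
        = deriv (U j) t - β (j / n) * U j t + α (j / n) * U j t ^ p :=
    fun j hj t ht => hU.deriv_eq (hwin j hj) (by linarith)
  have hpow : ∀ j : ℤ, |(j : ℝ)| ≤ (X + 2) * n → ∀ s t : ℝ, s ≤ t → t ≤ T →
      U j t ^ p - U j s ^ p ≤ Q * (B * (t - s)) := by
    intro j hj s t hst ht
    refine (rpow_sub_rpow_le_mul_sub hp1.le (hU0 j hj s (by linarith)) (hUmono j hj s t hst ht)
      (hUM j hj t ht)).trans ?_
    have := hUlip j hj s t hst ht
    gcongr
  have hsd : ∀ j : ℤ, |(j : ℝ)| ≤ (X + 2) * n → ∀ t ≤ T,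
      U (j + 1) t + U (j - 1) t - 2 * U j t ≤ K1 / n ^ 2 := by
    intro j hj t ht
    refine secondDiff_le_of_mul_le hC (hAC (j / n)) hn0 (by positivity) ?_
    rw [hUeq j hj t ht]
    have h1 := hWB j hj t ht
    have h2 := mul_nonneg (H.nonnegβ (j / n)) (hU0 j hj t ht)
    have h3 : α (j / n) * U j t ^ p ≤ a * M ^ p := by
      have h4 : U j t ^ p ≤ M ^ p :=
        Real.rpow_le_rpow (hU0 j hj t ht) (hUM j hj t ht) (by linarith)
      have := H.leα (j / n)
      have := Real.rpow_nonneg (hU0 j hj t ht) p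
      gcongr
    linarith
  have hsdz : ∀ j : ℤ, |(j : ℝ)| ≤ (X + 2) * n → ∀ s t : ℝ, s ≤ t → t ≤ T →
      (U (j + 1) t - U (j + 1) s) + (U (j - 1) t - U (j - 1) s) - 2 * (U j t - U j s)
        ≤ K3 * (t - s) / n ^ 2 := by
    intro j hj s t hst ht
    have hts : 0 ≤ t - s := by linarith
    rw [hK3, div_mul_eq_mul_div]
    refine secondDiff_le_of_mul_le hC (hAC (j / n)) hn0 (by positivity) ?_
    have e1 := hUeq j hj t ht
    have e2 := hUeq j hj s (hst.trans ht)
    have h1 := hWd j hj s t hst ht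
    have h2 := mul_le_mul_of_nonneg_left (hUmono j hj s t hst ht) (H.nonnegβ (j / n))
    have h3 : α (j / n) * (U j t ^ p - U j s ^ p) ≤ a * (Q * (B * (t - s))) := by
      have h4 := hpow j hj s t hst ht
      have := H.leα (j / n)
      have h5 : U j s ^ p ≤ U j t ^ p := Real.rpow_le_rpow (hU0 j hj s (by linarith))
        (hUmono j hj s t hst ht) (by linarith)
      have : 0 ≤ U j t ^ p - U j s ^ p := by linarith
      gcongr
    linarith
  have hsub : ∀ i : ℤ, |(i : ℝ)| ≤ X * n → |(i : ℝ)| ≤ (X + 2) * n := fun i hi => by linarith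
  have hwide : ∀ i : ℤ, |(i : ℝ)| ≤ X * n → ∀ j : ℤ, |j - i| ≤ (n : ℤ) + 1 →
      |(j : ℝ)| ≤ (X + 2) * n := by
    intro i hi j hj
    refine hmem i j (n + 1) (by linarith) ?_
    exact_mod_cast hj
  refine ⟨fun i hi => hU0 i (hsub i hi), ?_, fun i hi => hUmono i (hsub i hi), ?_, ?_, ?_, ?_, ?_⟩
  · intro i hi t ht
    refine (hUM i (hsub i hi) t ht).trans ?_
    linarith
  · intro i hi s t hst ht
    refine (hUlip i (hsub i hi) s t hst ht).trans ?_
    have : B ≤ L := by linarith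
    have : 0 ≤ t - s := by linarith
    gcongr
  · intro i hi
    have hi' := hsub i hi
    have hd : ∀ t ≤ T, HasDerivAt (fun t => U i t - L * t ^ 2) (deriv (U i) t - L * (2 * t)) t := by
      intro t ht
      exact ((hUd i hi' t ht).sub ((hasDerivAt_pow 2 t).const_mul L)).congr_deriv
        (by push_cast; ring)
    refine AntitoneOn.concaveOn_of_deriv (convex_Iic T)
      (fun t ht => (hd t ht).continuousAt.continuousWithinAt) ?_ ?_
    · rw [interior_Iic]
      exact fun t ht => (hd t (le_of_lt ht)).differentiableAt.differentiableWithinAt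
    · rw [interior_Iic]
      intro s hs t ht hst
      rw [(hd t (le_of_lt ht)).deriv, (hd s (le_of_lt hs)).deriv]
      have h1 := hWd i hi' s t hst (le_of_lt ht)
      have h2 : B ≤ L := by linarith
      nlinarith
  · intro i j hi hj t ht
    refine abs_sub_le_mul_of_forall_step (f := fun i => U i t) (R := X * n) ?_ hi hj
    intro i hi
    have h1 := abs_sub_le_of_secondDiff_le (f := fun i => U i t) (i := i) hn1 hK10
      (fun j hj => hU0 j (hwide i hi j hj) t ht) (fun j hj => hUM j (hwide i hi j hj) t ht)
      (fun j hj => hsd j (hwide i hi j (by omega)) t ht)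
    refine h1.trans ?_
    gcongr
    linarith
  · intro i j hi hj s t hst ht
    have hts : 0 ≤ t - s := by linarith
    refine abs_sub_le_mul_of_forall_step (f := fun i => U i t - U i s) (R := X * n) ?_ hi hj
    intro i hi
    have h1 := abs_sub_le_of_secondDiff_le (f := fun i => U i t - U i s) (i := i) hn1
      (K := K3 * (t - s)) (M := B * (t - s)) (by positivity)
      (fun j hj => by linarith [hUmono j (hwide i hi j hj) s t hst ht])
      (fun j hj => hUlip j (hwide i hi j hj) s t hst ht)
      (fun j hj => hsdz j (hwide i hi j (by omega)) s t hst ht)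
    refine h1.trans ?_
    rw [← add_mul]
    gcongr
    linarith
  · intro i k hik s t t' r ε hst' ht' ht hε hj
    have hσ : 0 < t' - s := by linarith
    have hwj : ∀ j : ℤ, |j - i| ≤ k + 1 → |(j : ℝ)| ≤ (X + 2) * n := by
      intro j hj
      refine hmem i j (k + 1) (by linarith) ?_
      exact_mod_cast hj
    set V : ℤ → ℝ → ℝ := fun j τ => ∫ x in s..τ, U j (min x T) with hV
    have hVd : ∀ j : ℤ, |(j : ℝ)| ≤ (X + 2) * n → ∀ τ ≤ T, HasDerivAt (V j) (U j τ) τ := by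
      intro j hj τ hτ
      have hc : Continuous fun x => U j (min x T) := by
        rw [continuous_iff_continuousAt]
        intro x
        exact (hUd j hj (min x T) (min_le_right _ _)).continuousAt.comp
          (f := fun x => min x T) (by fun_prop)
      have := intervalIntegral.integral_hasDerivAt_right (hc.intervalIntegrable s τ)
        (hc.stronglyMeasurableAtFilter _ _) hc.continuousAt
      rwa [min_eq_left hτ] at this
    have hVs : ∀ j, V j s = 0 := fun j => by simp [hV]
    have htT : t ≤ T := ht.2.trans ht'
    have hdiff : ∀ j : ℤ, |(j : ℝ)| ≤ (X + 2) * n → ∀ τ ∈ Icc s t',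
        |U j τ - U j t| ≤ B * (t' - s) := by
      intro j hj τ hτ
      rcases le_total τ t with h | h
      · have h1 := hUmono j hj τ t h htT
        rw [abs_sub_comm, abs_of_nonneg (by linarith)]
        refine (hUlip j hj τ t h htT).trans ?_
        have := ht.2; have := hτ.1
        gcongr
      · have h1 := hUmono j hj t τ h (hτ.2.trans ht')
        rw [abs_of_nonneg (by linarith)]
        refine (hUlip j hj t τ h (hτ.2.trans ht')).trans ?_
        have := hτ.2; have := ht.1
        gcongr
    have hVU : ∀ j : ℤ, |(j : ℝ)| ≤ (X + 2) * n →
        |V j t' - (t' - s) * U j t| ≤ B * (t' - s) * (t' - s) := by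
      intro j hj
      have h1 := norm_image_sub_le_of_norm_deriv_le_segment' (f := fun τ => V j τ - (τ - s) * U j t)
        (f' := fun τ => U j τ - U j t) (a := s) (b := t') (C := B * (t' - s))
        (fun τ hτ => by
          have h2 := ((hasDerivAt_id τ).sub_const s).mul_const (U j t)
          exact (((hVd j hj τ (hτ.2.trans ht')).sub h2).congr_deriv (by ring)).hasDerivWithinAt)
        (fun τ hτ => hdiff j hj τ ⟨hτ.1, hτ.2.le⟩) t' ⟨hst'.le, le_rfl⟩
      simpa [hVs] using h1
    have hVD : ∀ j : ℤ, |j - i| < k →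
        |V (j + 1) t' + V (j - 1) t' - 2 * V j t' - (t' - s) * r / n ^ 2|
          ≤ ((t' - s) * ε + C1 / C * (t' - s) * (t' - s)) / n ^ 2 := by
      intro j hjk
      have w0 := hwj j (by omega)
      have w1 := hwj (j + 1) (by rw [abs_le]; rw [abs_lt] at hjk; omega)
      have w2 := hwj (j - 1) (by rw [abs_le]; rw [abs_lt] at hjk; omega)
      have hAj := H.posA (j / n)
      set F : ℝ := β (j / n) * U j t - α (j / n) * U j t ^ p with hF
      have h1 := norm_image_sub_le_of_norm_deriv_le_segment'
        (f := fun τ => A (j / n) * n ^ 2 * (V (j + 1) τ + V (j - 1) τ - 2 * V j τ) - U j τ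
          + (τ - s) * F)
        (f' := fun τ => A (j / n) * n ^ 2 * (U (j + 1) τ + U (j - 1) τ - 2 * U j τ)
          - deriv (U j) τ + F) (a := s) (b := t') (C := C1 * (t' - s))
        (fun τ hτ => by
          have hτT := hτ.2.trans ht'
          have h2 := ((hasDerivAt_id τ).sub_const s).mul_const F
          have h3 := (((hVd _ w1 τ hτT).add (hVd _ w2 τ hτT)).sub
            ((hVd _ w0 τ hτT).const_mul 2)).const_mul (A (j / n) * n ^ 2)
          exact (((h3.sub (hUd j w0 τ hτT)).add h2).congr_deriv (by ring)).hasDerivWithinAt)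
        (fun τ hτ => by
          have hτ' : τ ∈ Icc s t' := ⟨hτ.1, hτ.2.le⟩
          have hτT := hτ'.2.trans ht'
          rw [hUeq j w0 τ hτT, Real.norm_eq_abs]
          have h2 := hdiff j w0 τ hτ'
          have h3 := abs_rpow_sub_rpow_le hp1.le (hU0 j w0 τ hτT) (hU0 j w0 t htT)
            (hUM j w0 τ hτT) (hUM j w0 t htT)
          have h4 : |β (j / n) * (U j τ - U j t)| ≤ b * (B * (t' - s)) := by
            rw [abs_mul, abs_of_nonneg (H.nonnegβ _)]
            have := H.leβ (j / n)
            gcongr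
          have h5 : |α (j / n) * (U j τ ^ p - U j t ^ p)| ≤ a * (Q * (B * (t' - s))) := by
            rw [abs_mul, abs_of_nonneg (H.posα _).le]
            have := H.leα (j / n)
            have : |U j τ ^ p - U j t ^ p| ≤ Q * (B * (t' - s)) := h3.trans (by gcongr)
            gcongr
          have h6 := abs_le.1 h4
          have h7 := abs_le.1 h5
          rw [abs_le]
          constructor <;> linarith [h6.1, h6.2, h7.1, h7.2]) t' ⟨hst'.le, le_rfl⟩
      simp only [hVs, sub_self, zero_mul, Real.norm_eq_abs, mul_zero, add_zero, zero_sub] at h1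
      have h2 := hj j hjk
      set D := V (j + 1) t' + V (j - 1) t' - 2 * V j t' with hD
      set c := curvature p A α β (j / n) ((U j t' - U j s) / (t' - s)) (U j t) with hc
      have h3 : A (j / n) * ((t' - s) * c) = U j t' - U j s - (t' - s) * F := by
        rw [hc, curvature, hF]
        field_simp
        ring
      have h4 : |A (j / n) * (n ^ 2 * D - (t' - s) * c)| ≤ C1 * (t' - s) * (t' - s) := by
        refine le_trans (le_of_eq ?_) h1
        congr 1
        linarith
      rw [abs_mul, abs_of_pos hAj] at h4
      have h5 : |n ^ 2 * D - (t' - s) * c| ≤ C1 / C * (t' - s) * (t' - s) := by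
        rw [div_mul_eq_mul_div, div_mul_eq_mul_div, le_div_iff₀ hC, mul_comm]
        exact (mul_le_mul_of_nonneg_right (hAC _) (abs_nonneg _)).trans h4
      have h6 : |n ^ 2 * D - (t' - s) * r| ≤ (t' - s) * ε + C1 / C * (t' - s) * (t' - s) := by
        have h7 : |(t' - s) * (c - r)| ≤ (t' - s) * ε := by
          rw [abs_mul, abs_of_pos hσ]; gcongr
        have h8 := abs_le.1 h5
        have h9 := abs_le.1 h7
        rw [abs_le]
        constructor <;> linarith [h8.1, h8.2, h9.1, h9.2]
      have h7 : D - (t' - s) * r / n ^ 2 = (n ^ 2 * D - (t' - s) * r) / n ^ 2 := by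
        field_simp
      rw [h7, abs_div, abs_of_pos (by positivity : (0 : ℝ) < n ^ 2)]
      gcongr
    have hup := add_add_sub_le_of_forall_secondDiff_le (f := fun j => V j t') (i := i) (k := k)
      (c := ((t' - s) * r + ((t' - s) * ε + C1 / C * (t' - s) * (t' - s))) / n ^ 2)
      (fun j hjk => by
        have := (abs_le.1 (hVD j hjk)).2
        rw [add_div]
        linarith)
    have hdn := add_add_sub_le_of_forall_secondDiff_le (f := fun j => -V j t') (i := i) (k := k)
      (c := (-((t' - s) * r) + ((t' - s) * ε + C1 / C * (t' - s) * (t' - s))) / n ^ 2)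
      (fun j hjk => by
        have := (abs_le.1 (hVD j hjk)).1
        rw [add_div, neg_div]
        linarith)
    have v0 := abs_le.1 (hVU i (hwj i (by simp; omega)))
    have v1 := abs_le.1 (hVU (i + k) (hwj _ (by simp)))
    have v2 := abs_le.1 (hVU (i - k) (hwj _ (by simp)))
    have hkn : ∀ q : ℝ, q / n ^ 2 * (k : ℝ) ^ 2 = q * (k / n) ^ 2 := fun q => by
      rw [div_pow]; ring
    rw [hkn] at hup hdn
    set D := U (i + k) t + U (i - k) t - 2 * U i t with hD
    set κ2 : ℝ := (k / n) ^ 2 with hκ2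
    have hκ20 : 0 ≤ κ2 := by positivity
    have hmain : (t' - s) * |D - r * κ2| ≤
        (t' - s) * ((ε + C1 / C * (t' - s)) * κ2 + 4 * B * (t' - s)) := by
      rw [← abs_of_pos hσ, ← abs_mul, abs_of_pos hσ, abs_le]
      constructor <;> nlinarith [v0.1, v0.2, v1.1, v1.2, v2.1, v2.2]
    refine (le_of_mul_le_mul_left hmain hσ).trans ?_
    have : C1 / C ≤ L := by linarith
    have : 4 * B ≤ L := by linarith
    gcongr

theorem exists_nat_mul_rpow_lt {q c : ℝ} (hq : q < 1) (hc : 0 < c) :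
    ∃ k : ℕ, c * (1 + (k : ℝ)) ^ q < k := by
  have h1 : Tendsto (fun k : ℕ => (1 + (k : ℝ)) ^ (-(1 - q))) atTop (𝓝 0) :=
    (tendsto_rpow_neg_atTop (by linarith)).comp
      (tendsto_atTop_add_const_left _ _ tendsto_natCast_atTop_atTop)
  obtain ⟨k, hk1, hk⟩ := ((eventually_ge_atTop 1).and
    (h1.eventually_lt_const (show 0 < 1 / (2 * c) by positivity))).exists
  refine ⟨k, ?_⟩
  have hk0 : (1 : ℝ) ≤ k := by exact_mod_cast hk1
  have h2 : (1 + (k : ℝ)) ^ q = (1 + k) * (1 + (k : ℝ)) ^ (-(1 - q)) := by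
    have h3 := Real.rpow_add (show (0 : ℝ) < 1 + k by linarith) 1 (-(1 - q))
    rwa [Real.rpow_one, show 1 + -(1 - q) = q by ring] at h3
  rw [lt_div_iff₀ (by positivity)] at hk
  rw [h2]
  nlinarith

set_option maxHeartbeats 1000000 in
/-- The grid solutions stay above a barrier that does not depend on the grid. -/
theorem IsAdmissible.exists_lower_bound {p m C a b : ℝ} {A α β : ℝ → ℝ}
    (H : IsAdmissible p m C a b A α β) :
    ∃ (δ : ℝ) (k : ℕ), 0 < δ ∧ ∀ n : ℕ, 2 ≤ n → k ≤ n → ∀ U, IsGridSol p A α β n U →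
      δ ≤ U (k * n) 1 := by
  obtain ⟨κ, hκ⟩ := H.exists_isSuperRate
  have hp1 := H.one_lt
  have hC := H.C_pos
  have ha : 0 ≤ a := (H.posα 0).le.trans (H.leα 0)
  set q : ℝ := max (1 / 2) (p + 2 - m) with hq
  have hq0 : 0 < q := lt_of_lt_of_le (by norm_num) (le_max_left _ _)
  have hq1 : q < 1 := max_lt (by norm_num) (by linarith [H.lt_m])
  have hqm : p ≤ m + (q - 2) := by linarith [le_max_right (1 / 2) (p + 2 - m)]
  have hqq : 0 < q * (1 - q) / 2 := by have : 0 < 1 - q := by linarith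
                                       positivity
  set c : ℝ := (2 + a) / (C * (q * (1 - q) / 2)) with hc
  have hc0 : 0 < c := by positivity
  have hcC : C * (c * (q * (1 - q) / 2)) = 2 + a := by
    rw [mul_left_comm, hc, div_mul_cancel₀ _ (by positivity)]
  obtain ⟨k, hk⟩ := exists_nat_mul_rpow_lt hq1 hc0
  refine ⟨k - c * ((1 + (k : ℝ)) ^ q - 1), k, by linarith, fun n hn hkn U hU => ?_⟩
  have hn1 : 1 ≤ n := by omega
  have hn0 : (2 : ℝ) ≤ n := by exact_mod_cast hn
  have hN : ∀ i : ℤ, 0 ≤ i → i ≤ (n : ℤ) ^ 2 → |i| ≤ (n : ℤ) ^ 2 := fun i h1 h2 => by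
    rwa [abs_of_nonneg h1]
  have hN' : ∀ i : ℤ, 0 < i → i < (n : ℤ) ^ 2 → |i| < (n : ℤ) ^ 2 := fun i h1 h2 => by
    rwa [abs_of_pos h1]
  have hx0 : ∀ i : ℤ, 0 ≤ i → (0 : ℝ) ≤ (i : ℝ) / n := fun i hi => by
    have : (0 : ℝ) ≤ i := by exact_mod_cast hi
    positivity
  have hone : ∀ i : ℤ, 0 ≤ i → 1 ≤ (1 + (i : ℝ) / n) ^ q := fun i hi =>
    Real.one_le_rpow (by linarith [hx0 i hi]) hq0.le
  set ζ : ℤ → ℝ → ℝ := fun i t => t ^ 2 * (i / n) - c * ((1 + (i : ℝ) / n) ^ q - 1) with hζ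
  have hζle : ∀ i : ℤ, 0 ≤ i → ∀ t, ζ i t ≤ t ^ 2 * (i / n) := fun i hi t => by
    have := hone i hi
    have : 0 ≤ c * ((1 + (i : ℝ) / n) ^ q - 1) := mul_nonneg hc0.le (by linarith)
    simp only [hζ]; linarith
  have hζd : ∀ (i : ℤ) (t : ℝ), HasDerivAt (ζ i) (2 * t * (i / n)) t := fun i t =>
    (((hasDerivAt_pow 2 t).mul_const _).sub_const _).congr_deriv (by push_cast; ring)
  have hζ2 : ∀ i : ℤ, 0 < i → ∀ t, (2 + a) * (1 + (i : ℝ) / n) ^ p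
      ≤ A (i / n) * n ^ 2 * (ζ (i + 1) t + ζ (i - 1) t - 2 * ζ i t) := by
    intro i hi t
    have hi' := hx0 i hi.le
    set X : ℝ := 1 + (i : ℝ) / n with hX
    have hX1 : 1 ≤ X := by linarith
    have h1 := rpow_add_add_rpow_sub_le (X := X) (h := 1 / n) hq0 hq1 (by positivity) (by
      have : (1 : ℝ) / n < 1 := by rw [div_lt_one (by linarith)]; linarith
      linarith)
    have e1 : 1 + ((i + 1 : ℤ) : ℝ) / n = X + 1 / n := by rw [hX]; push_cast; ring
    have e2 : 1 + ((i - 1 : ℤ) : ℝ) / n = X - 1 / n := by rw [hX]; push_cast; ring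
    have e3 : ζ (i + 1) t + ζ (i - 1) t - 2 * ζ i t
        = -c * ((X + 1 / n) ^ q + (X - 1 / n) ^ q - 2 * X ^ q) := by
      simp only [hζ, e1, e2, ← hX]; push_cast; ring
    have h2 : c * (q * (1 - q) / 2 * X ^ (q - 2) * (1 / n) ^ 2)
        ≤ ζ (i + 1) t + ζ (i - 1) t - 2 * ζ i t := by
      rw [e3]
      nlinarith [mul_le_mul_of_nonneg_left h1 hc0.le]
    have hA : C * X ^ m ≤ A (i / n) := by
      have := H.lower (i / n)
      rwa [abs_of_nonneg hi'] at this
    have hX2 := Real.rpow_nonneg (zero_le_one.trans hX1) (q - 2)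
    have hXm := Real.rpow_nonneg (zero_le_one.trans hX1) m
    calc (2 + a) * X ^ p ≤ (2 + a) * X ^ (m + (q - 2)) := by
          gcongr
      _ = (C * X ^ m) * n ^ 2 * (c * (q * (1 - q) / 2 * X ^ (q - 2) * (1 / n) ^ 2)) := by
          rw [Real.rpow_add (by linarith), ← hcC]
          field_simp
      _ ≤ _ := by
          have := H.posA (i / n)
          gcongr
  have h := le_mul_exp_of_subsolution (lo := 0) (hi := (n : ℤ) ^ 2) (a := 0) (b := 1)
    (K := 0) (κ := κ) (P := fun i => softAbs (i / n)) (c := fun i => A (i / n) * n ^ 2)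
    (e := fun i => β (i / n)) (y := fun i t => ζ i t - U i t)
    (y' := fun i t => 2 * t * (i / n) - (A (i / n) * n ^ 2 * (U (i + 1) t + U (i - 1) t - 2 * U i t)
      + β (i / n) * U i t - α (i / n) * U i t ^ p)) (fun _ => softAbs_pos _) le_rfl
    (fun i => by have := H.posA (i / n); positivity) (fun i _ _ => hκ.2 n hn1 i)
    (fun i h1 h2 t ht => ((hζd i t).continuousAt.sub
      (hU.continuousAt (hN i h1 h2) (by linarith [ht.2]))).continuousWithinAt)
    (fun i h1 h2 t ht => ((hζd i t).sub
      (hU.hasDerivAt i t (hN' i h1 h2) (by linarith [ht.2]))).hasDerivWithinAt)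
    (fun i h1 h2 => by
      have := hζle i h1 0
      have := hU.zero i 0 le_rfl
      simp only [zero_mul]
      linarith)
    (fun i h1 t ht => by
      simp only [zero_mul]
      have h2 : 0 ≤ i ∧ i ≤ (n : ℤ) ^ 2 := by
        rcases h1 with rfl | rfl
        · exact ⟨le_rfl, by positivity⟩
        · exact ⟨by positivity, le_rfl⟩
      have h3 := hζle i h2.1 t
      have h4 := hU.nonneg i t (hN i h2.1 h2.2) (by linarith [ht.2])
      rcases h1 with rfl | rfl
      · simp only [Int.cast_zero, zero_div, mul_zero] at h3
        linarith
      · have h5 := hU.bdry ((n : ℤ) ^ 2) t (by rw [abs_of_nonneg h2.1]) (by linarith [ht.2])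
        rw [max_eq_left ht.1] at h5
        have h6 : (((n : ℤ) ^ 2 : ℤ) : ℝ) / n = n := by push_cast; field_simp
        rw [h6] at h3
        linarith)
    (fun i h1 h2 t ht hy => by
      have h3 := hζ2 i h1 t
      have h4 := hζle i h1.le t
      have hx := hx0 i h1.le
      have ht1 : t ^ 2 ≤ 1 := by nlinarith [ht.1, ht.2]
      have hU0 := hU.nonneg i t (hN i h1.le h2.le) (by linarith [ht.2])
      have hUx : U i t ≤ 1 + (i : ℝ) / n := by nlinarith
      have h5 : α (i / n) * U i t ^ p ≤ a * (1 + (i : ℝ) / n) ^ p := by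
        have := H.leα (i / n)
        have := Real.rpow_nonneg hU0 p
        gcongr
      have h6 : (1 + (i : ℝ) / n) ^ (1 : ℝ) ≤ (1 + (i : ℝ) / n) ^ p :=
        Real.rpow_le_rpow_of_exponent_le (by linarith) hp1.le
      rw [Real.rpow_one] at h6
      have h7 : 2 * t * ((i : ℝ) / n) ≤ 2 * (1 + (i : ℝ) / n) := by
        nlinarith [ht.1, ht.2, mul_nonneg hx (by linarith [ht.2] : 0 ≤ 1 - t)]
      have h8 : 0 ≤ β (i / n) * ζ i t := mul_nonneg (H.nonnegβ _) (by linarith)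
      nlinarith)
    (i := k * n) (by positivity) (by rw [pow_two]; gcongr) (t := 1) ⟨zero_le_one, le_rfl⟩
  have hkx : ((k * n : ℤ) : ℝ) / n = k := by push_cast; field_simp
  simp only [zero_mul, hζ, hkx] at h
  linarith

/-- `u` is the limit of the grid functions `U n` along `l`. -/
def IsGridLimit (l : Filter ℕ) (U : ℕ → ℤ → ℝ → ℝ) (u : ℝ → ℝ → ℝ) : Prop :=
  ∀ (x t : ℝ) (i : ℕ → ℤ), Tendsto (fun n => (i n : ℝ) / n) l (𝓝 x) →
    Tendsto (fun n => U n (i n) t) l (𝓝 (u x t))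

theorem tendsto_floor_mul_div_natCast (x : ℝ) :
    Tendsto (fun n : ℕ => (⌊x * n⌋ : ℝ) / n) atTop (𝓝 x) := by
  have h1 : Tendsto (fun n : ℕ => x - 1 / (n : ℝ)) atTop (𝓝 x) := by
    simpa using (tendsto_const_nhds (x := x)).sub tendsto_one_div_atTop_nhds_zero_nat
  refine tendsto_of_tendsto_of_tendsto_of_le_of_le' h1 tendsto_const_nhds ?_ ?_
  · filter_upwards [eventually_ge_atTop 1] with n hn
    have hn0 : (0 : ℝ) < n := by exact_mod_cast hn
    rw [le_div_iff₀ hn0, sub_mul, one_div_mul_cancel hn0.ne']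
    exact (Int.sub_one_lt_floor _).le
  · filter_upwards [eventually_ge_atTop 1] with n hn
    have hn0 : (0 : ℝ) < n := by exact_mod_cast hn
    rw [div_le_iff₀ hn0]
    exact Int.floor_le _

theorem eventually_abs_le_mul {l : Filter ℕ} (hl : l ≤ atTop) {i : ℕ → ℤ} {x X : ℝ}
    (hi : Tendsto (fun n => (i n : ℝ) / n) l (𝓝 x)) (hx : |x| < X) :
    ∀ᶠ n in l, |(i n : ℝ)| ≤ X * n := by
  filter_upwards [hi.abs.eventually_lt_const hx, hl (eventually_ge_atTop 1)] with n h1 hn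
  have hn0 : (0 : ℝ) < n := by exact_mod_cast hn
  rw [abs_div, abs_of_pos hn0, div_lt_iff₀ hn0] at h1
  exact h1.le

theorem exists_isGridLimit {p : ℝ} {A α β : ℝ → ℝ} {U : ℕ → ℤ → ℝ → ℝ}
    (hU : ∀ X T : ℝ, 0 ≤ X → 1 ≤ T → ∃ L, 0 ≤ L ∧ ∃ n₀ : ℕ, ∀ n : ℕ, n₀ ≤ n →
      HasLocalBounds p A α β X T L n (U n)) (l : Ultrafilter ℕ) (hl : (l : Filter ℕ) ≤ atTop) :
    ∃ u, IsGridLimit l U u := by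
  have h1 : ∀ x t : ℝ, ∃ v, Tendsto (fun n : ℕ => U n ⌊x * n⌋ t) l (𝓝 v) := by
    intro x t
    obtain ⟨L, -, n₀, hL⟩ := hU (|x| + 1) (max 1 t) (by positivity) (le_max_left _ _)
    have hev : ∀ᶠ n in (l : Filter ℕ), U n ⌊x * n⌋ t ∈ Icc 0 L := by
      filter_upwards [hl (eventually_ge_atTop n₀),
        eventually_abs_le_mul hl ((tendsto_floor_mul_div_natCast x).mono_left hl)
          (lt_add_one |x|)] with n hn hi
      exact ⟨(hL n hn).nonneg _ hi t (le_max_right _ _), (hL n hn).le _ hi t (le_max_right _ _)⟩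
    obtain ⟨v, -, hv⟩ := isCompact_Icc.ultrafilter_le_nhds' (l.map fun n : ℕ => U n ⌊x * n⌋ t) hev
    exact ⟨v, hv⟩
  choose u hu using h1
  refine ⟨u, fun x t i hi => ?_⟩
  obtain ⟨L, -, n₀, hL⟩ := hU (|x| + 1) (max 1 t) (by positivity) (le_max_left _ _)
  have hfl := (tendsto_floor_mul_div_natCast x).mono_left hl
  have h2 : Tendsto (fun n => L * |(i n : ℝ) / n - ⌊x * n⌋ / n|) l (𝓝 0) := by
    simpa using ((hi.sub hfl).abs.const_mul L)
  have h3 : Tendsto (fun n => U n (i n) t - U n ⌊x * n⌋ t) l (𝓝 0) := by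
    refine squeeze_zero_norm' ?_ h2
    filter_upwards [hl (eventually_ge_atTop n₀), hl (eventually_ge_atTop 1),
      eventually_abs_le_mul hl hi (lt_add_one |x|),
      eventually_abs_le_mul hl hfl (lt_add_one |x|)] with n hn hn1 hi1 hi2
    have hn0 : (0 : ℝ) < n := by exact_mod_cast hn1
    refine ((hL n hn).lip_space _ _ hi2 hi1 t (le_max_right _ _)).trans (le_of_eq ?_)
    rw [← sub_div, abs_div, abs_of_pos hn0]
    ring
  simpa using h3.add (hu x t)

/-- The local bounds inherited by a limit of grid solutions. -/
structure HasLimitBounds (p : ℝ) (A α β : ℝ → ℝ) (X T L : ℝ) (u : ℝ → ℝ → ℝ) : Prop where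
  nonneg : ∀ x, |x| ≤ X → ∀ t ≤ T, 0 ≤ u x t
  lip_time : ∀ x, |x| ≤ X → ∀ s t : ℝ, s ≤ t → t ≤ T → |u x t - u x s| ≤ L * (t - s)
  concave : ∀ x, |x| ≤ X → ConcaveOn ℝ (Iic T) fun t => u x t - L * t ^ 2
  lip_space : ∀ x y : ℝ, |x| ≤ X → |y| ≤ X → ∀ t ≤ T, |u y t - u x t| ≤ L * |y - x|
  lip_mixed : ∀ x y : ℝ, |x| ≤ X → |y| ≤ X → ∀ s t : ℝ, s ≤ t → t ≤ T →
    |(u y t - u y s) - (u x t - u x s)| ≤ L * (t - s) * |y - x|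
  secondDiff : ∀ x η : ℝ, 0 < η → |x| + η ≤ X → ∀ s t t' r ε : ℝ, s < t' → t' ≤ T →
    t ∈ Icc s t' → 0 ≤ ε →
    (∀ y w v : ℝ, |y - x| ≤ 2 * η → |w - (u x t' - u x s) / (t' - s)| ≤ (L + 1) * η →
      |v - u x t| ≤ (L + 1) * η → |curvature p A α β y w v - r| ≤ ε) →
    |u (x + η) t + u (x - η) t - 2 * u x t - r * η ^ 2| ≤ (ε + L * (t' - s)) * η ^ 2 + L * (t' - s)

theorem IsGridLimit.hasLimitBounds {p X T L : ℝ} {A α β : ℝ → ℝ} {U : ℕ → ℤ → ℝ → ℝ}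
    {u : ℝ → ℝ → ℝ} {l : Filter ℕ} [l.NeBot] (hu : IsGridLimit l U u) (hl : l ≤ atTop) {n₀ : ℕ}
    (hL0 : 0 ≤ L) (hL : ∀ n : ℕ, n₀ ≤ n → HasLocalBounds p A α β (X + 1) T L n (U n)) :
    HasLimitBounds p A α β X T L u := by
  have hev : ∀ᶠ n : ℕ in l, 0 < (n : ℝ) ∧ HasLocalBounds p A α β (X + 1) T L n (U n) := by
    filter_upwards [hl (eventually_ge_atTop n₀), hl (eventually_ge_atTop 1)] with n hn hn1
    exact ⟨by exact_mod_cast hn1, hL n hn⟩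
  have hfl : ∀ x : ℝ, Tendsto (fun n : ℕ => (⌊x * n⌋ : ℝ) / n) l (𝓝 x) := fun x =>
    (tendsto_floor_mul_div_natCast x).mono_left hl
  have hwin : ∀ x : ℝ, |x| ≤ X → ∀ᶠ n : ℕ in l, |(⌊x * n⌋ : ℝ)| ≤ (X + 1) * n := fun x hx =>
    eventually_abs_le_mul hl (hfl x) (by linarith)
  have hlim : ∀ x t : ℝ, Tendsto (fun n : ℕ => U n ⌊x * n⌋ t) l (𝓝 (u x t)) := fun x t =>
    hu x t _ (hfl x)
  have hdist : ∀ x y : ℝ, Tendsto (fun n : ℕ => |(⌊y * n⌋ : ℝ) / n - ⌊x * n⌋ / n|) l (𝓝 |y - x|) :=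
    fun x y => ((hfl y).sub (hfl x)).abs
  refine ⟨?_, ?_, ?_, ?_, ?_, ?_⟩
  · intro x hx t ht
    refine ge_of_tendsto (hlim x t) ?_
    filter_upwards [hev, hwin x hx] with n hn hi using hn.2.nonneg _ hi t ht
  · intro x hx s t hst ht
    refine le_of_tendsto ((hlim x t).sub (hlim x s)).abs ?_
    filter_upwards [hev, hwin x hx] with n hn hi
    rw [abs_of_nonneg (sub_nonneg.2 (hn.2.mono _ hi s t hst ht))]
    exact hn.2.lip_time _ hi s t hst ht
  · intro x hx
    refine ⟨convex_Iic T, fun s hs t ht c d hc hd hcd => ?_⟩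
    refine le_of_tendsto_of_tendsto
      ((((hlim x s).sub_const (L * s ^ 2)).const_smul c).add
        (((hlim x t).sub_const (L * t ^ 2)).const_smul d))
      ((hlim x (c • s + d • t)).sub_const (L * (c • s + d • t) ^ 2)) ?_
    filter_upwards [hev, hwin x hx] with n hn hi using (hn.2.concave _ hi).2 hs ht hc hd hcd
  · intro x y hx hy t ht
    refine le_of_tendsto_of_tendsto ((hlim y t).sub (hlim x t)).abs ((hdist x y).const_mul L) ?_
    filter_upwards [hev, hwin x hx, hwin y hy] with n hn hi hj
    refine (hn.2.lip_space _ _ hi hj t ht).trans (le_of_eq ?_)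
    rw [← sub_div, abs_div, abs_of_pos hn.1]
    ring
  · intro x y hx hy s t hst ht
    refine le_of_tendsto_of_tendsto
      (((hlim y t).sub (hlim y s)).sub ((hlim x t).sub (hlim x s))).abs
      ((hdist x y).const_mul (L * (t - s))) ?_
    filter_upwards [hev, hwin x hx, hwin y hy] with n hn hi hj
    refine (hn.2.lip_mixed _ _ hi hj s t hst ht).trans (le_of_eq ?_)
    rw [← sub_div, abs_div, abs_of_pos hn.1]
    ring
  · intro x η hη hxη s t t' r ε hst' ht' ht hε hcurv
    have hσ : 0 < t' - s := by linarith
    have hηfl : Tendsto (fun n : ℕ => (⌊η * n⌋₊ : ℝ) / n) l (𝓝 η) :=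
      (tendsto_nat_floor_mul_div_atTop hη.le).comp tendsto_natCast_atTop_atTop |>.mono_left hl
    have hp : Tendsto (fun n : ℕ => U n (⌊x * n⌋ + ⌊η * n⌋₊) t) l (𝓝 (u (x + η) t)) := by
      refine hu _ _ _ (((hfl x).add hηfl).congr fun n => ?_)
      push_cast; ring
    have hm : Tendsto (fun n : ℕ => U n (⌊x * n⌋ - ⌊η * n⌋₊) t) l (𝓝 (u (x - η) t)) := by
      refine hu _ _ _ (((hfl x).sub hηfl).congr fun n => ?_)
      push_cast; ring
    refine le_of_tendsto_of_tendsto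
      (((hp.add hm).sub ((hlim x t).const_mul 2)).sub ((hηfl.pow 2).const_mul r)).abs
      (((hηfl.pow 2).const_mul (ε + L * (t' - s))).add_const (L * (t' - s))) ?_
    have hquot := (((hlim x t').sub (hlim x s)).div_const (t' - s)).sub_const
      ((u x t' - u x s) / (t' - s)) |>.abs
    rw [sub_self, abs_zero] at hquot
    have hval := ((hlim x t).sub_const (u x t)).abs
    rw [sub_self, abs_zero] at hval
    have hpos := ((hfl x).sub_const x).abs
    rw [sub_self, abs_zero] at hpos
    filter_upwards [hev, hwin x (by linarith), hquot.eventually_le_const hη,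
      hval.eventually_le_const hη, hpos.eventually_le_const hη,
      (((hfl x).abs.add hηfl).eventually_lt_const (show |x| + η < X + 1 by linarith))]
      with n hn hi h1 h2 h3 h4
    obtain ⟨hn0, hB⟩ := hn
    have hk : (⌊η * n⌋₊ : ℝ) ≤ η * n := Nat.floor_le (by positivity)
    have hwk : |(⌊x * n⌋ : ℝ)| + ⌊η * n⌋₊ ≤ (X + 1) * n := by
      rw [abs_div, abs_of_pos hn0, ← add_div, div_lt_iff₀ hn0] at h4
      exact h4.le
    refine hB.secondDiff ⌊x * n⌋ ⌊η * n⌋₊ hwk s t t' r ε hst' ht' ht hε fun j hj => ?_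
    have hj' : |(j : ℝ) - ⌊x * n⌋| ≤ η * n := by
      have : |(j : ℝ) - ⌊x * n⌋| < (⌊η * n⌋₊ : ℝ) := by exact_mod_cast hj
      linarith
    have hjw : |(j : ℝ)| ≤ (X + 1) * n := by
      have h5 : |(j : ℝ) - ⌊x * n⌋| ≤ (⌊η * n⌋₊ : ℝ) := by exact_mod_cast hj.le
      have : (j : ℝ) = ⌊x * n⌋ + (j - ⌊x * n⌋) := by ring
      rw [this]
      exact (abs_add_le _ _).trans (by linarith)
    have hLn : L / n * |(j : ℝ) - ⌊x * n⌋| ≤ L * η := by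
      rw [div_mul_eq_mul_div, div_le_iff₀ hn0, mul_assoc]
      gcongr
    refine hcurv _ _ _ ?_ ?_ ?_
    · have h5 : |(j : ℝ) / n - ⌊x * n⌋ / n| ≤ η := by
        rw [← sub_div, abs_div, abs_of_pos hn0, div_le_iff₀ hn0]
        exact hj'
      exact (abs_sub_le _ (⌊x * n⌋ / n : ℝ) _).trans (by linarith)
    · have h5 := hB.lip_mixed _ _ hi hjw s t' hst'.le ht'
      have h6 : |(U n j t' - U n j s) / (t' - s)
          - (U n ⌊x * n⌋ t' - U n ⌊x * n⌋ s) / (t' - s)| ≤ L * η := by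
        rw [← sub_div, abs_div, abs_of_pos hσ, div_le_iff₀ hσ]
        refine h5.trans ?_
        calc _ = (L / n * |(j : ℝ) - ⌊x * n⌋|) * (t' - s) := by ring
          _ ≤ L * η * (t' - s) := by gcongr
      exact (abs_sub_le _ _ _).trans ((add_le_add h6 h1).trans (by linarith))
    · have h5 := (hB.lip_space _ _ hi hjw t (ht.2.trans ht')).trans hLn
      exact (abs_sub_le _ _ _).trans ((add_le_add h5 h2).trans (by linarith))

theorem ConcaveOn.continuousAt_deriv {g : ℝ → ℝ} {S : Set ℝ} {t : ℝ} (hg : ConcaveOn ℝ S g)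
    (hS : S ∈ 𝓝 t) (hd : ∀ s ∈ S, DifferentiableAt ℝ g s) : ContinuousAt (deriv g) t := by
  have htS := mem_of_mem_nhds hS
  have hslope : ∀ y, y ≠ t → Tendsto (fun s => slope g s y) (𝓝 t) (𝓝 (slope g t y)) := by
    intro y hy
    have h1 := (hd t htS).continuousAt
    have h2 : ContinuousAt (fun s => (y - s)⁻¹ • (g y - g s)) t :=
      ((continuousAt_const.sub continuousAt_id).inv₀ (sub_ne_zero.2 hy)).smul
        (continuousAt_const.sub h1)
    simpa [slope, ContinuousAt, vsub_eq_sub] using h2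
  have hderiv := hasDerivAt_iff_tendsto_slope.1 (hd t htS).hasDerivAt
  refine tendsto_order.2 ⟨fun b hb => ?_, fun b hb => ?_⟩
  · obtain ⟨y, ⟨hyb, hyS⟩, hy⟩ := ((((hderiv.mono_left
      (nhdsWithin_mono t (show Ioi t ⊆ {t}ᶜ from fun y hy => ne_of_gt hy))).eventually_const_lt hb).and
        (mem_nhdsWithin_of_mem_nhds hS)).and self_mem_nhdsWithin).exists
    filter_upwards [(hslope y (ne_of_gt hy)).eventually_const_lt hyb, hS, Iio_mem_nhds hy]
      with s h1 h2 h3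
    exact h1.trans_le (hg.slope_le_deriv h2 hyS h3 (hd s h2))
  · obtain ⟨y, ⟨hyb, hyS⟩, hy⟩ := ((((hderiv.mono_left
      (nhdsWithin_mono t (show Iio t ⊆ {t}ᶜ from fun y hy => ne_of_lt hy))).eventually_lt_const hb).and
        (mem_nhdsWithin_of_mem_nhds hS)).and self_mem_nhdsWithin).exists
    filter_upwards [(hslope y (ne_of_lt hy)).eventually_lt_const hyb, hS, Ioi_mem_nhds hy]
      with s h1 h2 h3
    refine lt_of_le_of_lt ?_ h1
    rw [slope_comm]
    exact hg.deriv_le_slope hyS h2 h3 (hd s h2)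

theorem ConcaveOn.exists_hasDerivWithinAt_Ioi {g : ℝ → ℝ} {S : Set ℝ} {t : ℝ}
    (hg : ConcaveOn ℝ S g) (ht : t ∈ interior S) : ∃ w, HasDerivWithinAt g w (Ioi t) t := by
  have := (hg.neg.differentiableWithinAt_Ioi_of_mem_interior ht).neg.hasDerivWithinAt
  simp only [Pi.neg_def, neg_neg] at this
  exact ⟨_, this⟩

theorem ConcaveOn.exists_hasDerivWithinAt_Iio {g : ℝ → ℝ} {S : Set ℝ} {t : ℝ}
    (hg : ConcaveOn ℝ S g) (ht : t ∈ interior S) : ∃ w, HasDerivWithinAt g w (Iio t) t := by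
  have := (hg.neg.differentiableWithinAt_Iio_of_mem_interior ht).neg.hasDerivWithinAt
  simp only [Pi.neg_def, neg_neg] at this
  exact ⟨_, this⟩

theorem eq_of_schwarz {D : ℝ → ℝ} {r₁ r₂ : ℝ}
    (h₁ : ∀ ε > 0, ∃ δ > 0, ∀ η, 0 < η → η < δ → |D η - r₁ * η ^ 2| ≤ ε * η ^ 2)
    (h₂ : ∀ ε > 0, ∃ δ > 0, ∀ η, 0 < η → η < δ → |D η - r₂ * η ^ 2| ≤ ε * η ^ 2) : r₁ = r₂ := by
  refine eq_of_forall_dist_le fun ε hε => ?_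
  obtain ⟨δ₁, hδ₁, h₁⟩ := h₁ (ε / 2) (by positivity)
  obtain ⟨δ₂, hδ₂, h₂⟩ := h₂ (ε / 2) (by positivity)
  obtain ⟨η, hη0, hη⟩ := exists_between (lt_min hδ₁ hδ₂)
  have e1 := abs_le.1 (h₁ η hη0 (hη.trans_le (min_le_left _ _)))
  have e2 := abs_le.1 (h₂ η hη0 (hη.trans_le (min_le_right _ _)))
  have hη2 : 0 < η ^ 2 := by positivity
  rw [Real.dist_eq, abs_le]
  constructor
  · refine le_of_mul_le_mul_right ?_ hη2
    linarith [e1.1, e2.2]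
  · refine le_of_mul_le_mul_right ?_ hη2
    linarith [e1.2, e2.1]

/-- `u` satisfies the limit bounds on every bounded window. -/
def IsLimitSolution (p : ℝ) (A α β : ℝ → ℝ) (u : ℝ → ℝ → ℝ) : Prop :=
  ∀ X T : ℝ, 0 ≤ X → 1 ≤ T → ∃ L, 0 ≤ L ∧ HasLimitBounds p A α β X T L u

theorem IsAdmissible.continuous_curvature {p m C a b : ℝ} {A α β : ℝ → ℝ}
    (H : IsAdmissible p m C a b A α β) :
    Continuous fun q : ℝ × ℝ × ℝ => curvature p A α β q.1 q.2.1 q.2.2 := by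
  have hA := H.contA
  have hα := H.contα
  have hβ := H.contβ
  have hpow : Continuous fun q : ℝ × ℝ × ℝ => q.2.2 ^ p :=
    continuous_snd.snd.rpow_const fun _ => Or.inr (by linarith [H.one_lt])
  unfold curvature
  exact ((continuous_snd.fst.sub ((hβ.comp continuous_fst).mul continuous_snd.snd)).add
    ((hα.comp continuous_fst).mul hpow)).div (hA.comp continuous_fst) fun q => (H.posA _).ne'

namespace IsLimitSolution

variable {p m C a b : ℝ} {A α β : ℝ → ℝ} {u : ℝ → ℝ → ℝ}

theorem exists_bounds (hu : IsLimitSolution p A α β u) (x t : ℝ) :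
    ∃ L, 0 ≤ L ∧ HasLimitBounds p A α β (|x| + 1) (max 1 (t + 1)) L u :=
  hu _ _ (by positivity) (le_max_left _ _)

theorem nonneg (hu : IsLimitSolution p A α β u) (x t : ℝ) : 0 ≤ u x t := by
  obtain ⟨L, -, h⟩ := hu.exists_bounds x t
  exact h.nonneg x (by linarith) t ((by linarith : t ≤ t + 1).trans (le_max_right _ _))

theorem schwarz (hu : IsLimitSolution p A α β u) (H : IsAdmissible p m C a b A α β) {x t w : ℝ}
    (hw : ∀ δ > 0, ∃ s t' : ℝ, s < t' ∧ t' - s < δ ∧ t ∈ Icc s t' ∧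
      |(u x t' - u x s) / (t' - s) - w| < δ) :
    ∀ ε > 0, ∃ δ > 0, ∀ η, 0 < η → η < δ →
      |u (x + η) t + u (x - η) t - 2 * u x t - curvature p A α β x w (u x t) * η ^ 2|
        ≤ ε * η ^ 2 := by
  intro ε hε
  obtain ⟨L, hL0, hL⟩ := hu.exists_bounds x t
  obtain ⟨δ₀, hδ₀, hcurv⟩ := Metric.continuous_iff.1 H.continuous_curvature (x, w, u x t) ε hε
  refine ⟨min 1 (δ₀ / (2 * (L + 2))), by positivity, fun η hη0 hη => ?_⟩
  have hη1 : η < 1 := hη.trans_le (min_le_left _ _)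
  have hη2 : (L + 2) * η < δ₀ / 2 := by
    have := hη.trans_le (min_le_right _ _)
    rw [lt_div_iff₀ (by positivity)] at this
    linarith
  have hLη : 0 ≤ L * η := by positivity
  refine le_of_forall_pos_le_add fun e he => ?_
  obtain ⟨s, t', hst, hσ, ht, hq⟩ := hw (min (min 1 (δ₀ / 2)) (e / (2 * (L + 1)))) (by positivity)
  have hσ1 : t' - s < 1 := hσ.trans_le ((min_le_left _ _).trans (min_le_left _ _))
  have hσ2 : L * (t' - s) ≤ e / 2 := by
    have := hσ.trans_le (min_le_right _ _)
    rw [lt_div_iff₀ (by positivity)] at this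
    nlinarith
  have hq' := hq.trans_le ((min_le_left _ _).trans (min_le_right _ _))
  have hs0 : 0 ≤ L * (t' - s) := mul_nonneg hL0 (by linarith)
  have hη21 : η ^ 2 ≤ 1 := by nlinarith
  refine (hL.secondDiff x η hη0 (by linarith) s t t' _ ε hst ?_ ht hε.le ?_).trans ?_
  · exact (by linarith [ht.1, ht.2] : t' ≤ t + 1).trans (le_max_right _ _)
  · intro y w' v hy hw' hv
    have h1 : |w' - w| < δ₀ := (abs_sub_le _ _ _).trans_lt
      ((add_lt_add_of_le_of_lt hw' hq').trans_le (by linarith))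
    have h2 := hcurv (y, w', v) (by
      rw [Prod.dist_eq, Prod.dist_eq, Real.dist_eq, Real.dist_eq, Real.dist_eq]
      exact max_lt (by linarith) (max_lt h1 (by linarith)))
    rw [Real.dist_eq] at h2
    exact h2.le
  · nlinarith

theorem exists_hasDerivAt (hu : IsLimitSolution p A α β u) (H : IsAdmissible p m C a b A α β)
    (x t : ℝ) : ∃ w, HasDerivAt (u x) w t := by
  obtain ⟨L, hL0, hL⟩ := hu.exists_bounds x t
  have htT : t ∈ interior (Iic (max 1 (t + 1))) := by
    rw [interior_Iic]
    exact (lt_add_one t).trans_le (le_max_right _ _)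
  have hquad : HasDerivAt (fun s : ℝ => L * s ^ 2) (L * (2 * t)) t :=
    ((hasDerivAt_pow 2 t).const_mul L).congr_deriv (by push_cast; ring)
  have hconc := hL.concave x (by linarith)
  obtain ⟨w₁, h₁⟩ := hconc.exists_hasDerivWithinAt_Ioi htT
  obtain ⟨w₂, h₂⟩ := hconc.exists_hasDerivWithinAt_Iio htT
  replace h₁ := h₁.add hquad.hasDerivWithinAt
  replace h₂ := h₂.add hquad.hasDerivWithinAt
  simp only [Pi.add_def, sub_add_cancel] at h₁ h₂
  set v₁ := w₁ + L * (2 * t)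
  set v₂ := w₂ + L * (2 * t)
  have s₁ := hu.schwarz H (x := x) (t := t) (w := v₁) (fun δ hδ => by
    have h3 := (hasDerivWithinAt_iff_tendsto_slope' self_notMem_Ioi).1 h₁
    obtain ⟨y, ⟨hy1, hy2⟩, hy3⟩ := (((Metric.tendsto_nhds.1 h3 δ hδ).and
      (mem_nhdsWithin_of_mem_nhds (Iio_mem_nhds (lt_add_of_pos_right t hδ)))).and
        self_mem_nhdsWithin).exists
    have hy2' : y < t + δ := hy2
    have hy3' : t < y := hy3
    refine ⟨t, y, hy3, by linarith, ⟨le_rfl, hy3'.le⟩, ?_⟩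
    rwa [slope_def_field, Real.dist_eq] at hy1)
  have s₂ := hu.schwarz H (x := x) (t := t) (w := v₂) (fun δ hδ => by
    have h3 := (hasDerivWithinAt_iff_tendsto_slope' self_notMem_Iio).1 h₂
    obtain ⟨y, ⟨hy1, hy2⟩, hy3⟩ := (((Metric.tendsto_nhds.1 h3 δ hδ).and
      (mem_nhdsWithin_of_mem_nhds (Ioi_mem_nhds (sub_lt_self t hδ)))).and
        self_mem_nhdsWithin).exists
    have hy2' : t - δ < y := hy2
    have hy3' : y < t := hy3
    refine ⟨y, t, hy3, by linarith, ⟨hy3'.le, le_rfl⟩, ?_⟩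
    rwa [slope_comm, slope_def_field, Real.dist_eq] at hy1)
  have heq := eq_of_schwarz s₁ s₂
  rw [curvature, curvature, div_left_inj' (H.posA x).ne'] at heq
  have hv : v₁ = v₂ := by linarith
  rw [← hv] at h₂
  exact ⟨v₁, hasDerivAt_iff_tendsto_slope_left_right.2
    ⟨(hasDerivWithinAt_iff_tendsto_slope' self_notMem_Iio).1 h₂,
      (hasDerivWithinAt_iff_tendsto_slope' self_notMem_Ioi).1 h₁⟩⟩

theorem hasDerivAt_deriv (hu : IsLimitSolution p A α β u) (H : IsAdmissible p m C a b A α β)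
    (x t : ℝ) : HasDerivAt (u x) (deriv (u x) t) t := by
  obtain ⟨w, hw⟩ := hu.exists_hasDerivAt H x t
  exact hw.differentiableAt.hasDerivAt

theorem continuous_deriv_left (hu : IsLimitSolution p A α β u) (H : IsAdmissible p m C a b A α β)
    (t : ℝ) : Continuous fun x => deriv (u x) t := by
  rw [continuous_iff_continuousAt]
  intro x
  obtain ⟨L, hL0, hL⟩ := hu.exists_bounds x t
  have hlip : ∀ y, |y| ≤ |x| + 1 → |deriv (u y) t - deriv (u x) t| ≤ L * |y - x| := by
    intro y hy
    refine le_of_tendsto (((hu.hasDerivAt_deriv H y t).tendsto_slope_zero_left).sub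
      (hu.hasDerivAt_deriv H x t).tendsto_slope_zero_left).abs ?_
    filter_upwards [self_mem_nhdsWithin] with h (hh : h < 0)
    have h1 := hL.lip_mixed x y (by linarith) hy (t + h) t (by linarith)
      ((by linarith : t ≤ t + 1).trans (le_max_right _ _))
    rw [smul_eq_mul, smul_eq_mul, ← mul_sub, abs_mul, abs_of_neg (inv_lt_zero.2 hh), ← inv_neg,
      inv_mul_le_iff₀ (by linarith), ← abs_neg]
    refine le_trans (le_of_eq ?_) (h1.trans (le_of_eq ?_))
    · congr 1; ring
    · ring
  refine tendsto_iff_norm_sub_tendsto_zero.2 (squeeze_zero_norm' ?_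
    (show Tendsto (fun y => L * |y - x|) (𝓝 x) (𝓝 0) from ?_))
  · have h1 : ∀ᶠ y in 𝓝 x, |y| < |x| + 1 :=
      continuous_abs.continuousAt.eventually_lt_const (lt_add_one _)
    filter_upwards [h1] with y hy
    rw [norm_norm]
    exact hlip y hy.le
  · have : Continuous fun y => L * |y - x| := by fun_prop
    simpa using this.tendsto x

theorem continuous_deriv (hu : IsLimitSolution p A α β u) (H : IsAdmissible p m C a b A α β)
    (x : ℝ) : Continuous (deriv (u x)) := by
  rw [continuous_iff_continuousAt]
  intro t
  obtain ⟨L, hL0, hL⟩ := hu.exists_bounds x t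
  have hg : ∀ s, HasDerivAt (fun t => u x t - L * t ^ 2) (deriv (u x) s - L * (2 * s)) s := fun s =>
    ((hu.hasDerivAt_deriv H x s).sub ((hasDerivAt_pow 2 s).const_mul L)).congr_deriv
      (by push_cast; ring)
  have h1 := (hL.concave x (by linarith)).continuousAt_deriv
    (Iic_mem_nhds ((lt_add_one t).trans_le (le_max_right _ _))) fun s _ => (hg s).differentiableAt
  have h2 : deriv (fun t => u x t - L * t ^ 2) = fun s => deriv (u x) s - L * (2 * s) :=
    funext fun s => (hg s).deriv
  rw [h2] at h1
  have h3 : ContinuousAt (fun s => L * (2 * s)) t := by fun_prop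
  simpa [Pi.add_def] using h1.add h3

theorem continuous (hu : IsLimitSolution p A α β u) :
    Continuous fun q : ℝ × ℝ => u q.1 q.2 := by
  rw [continuous_iff_continuousAt]
  rintro ⟨x, t⟩
  obtain ⟨L, hL0, hL⟩ := hu.exists_bounds x t
  refine tendsto_iff_norm_sub_tendsto_zero.2 (squeeze_zero_norm' (a := fun q : ℝ × ℝ =>
    L * |q.1 - x| + L * |q.2 - t|) ?_ ?_)
  · have h1 : ∀ᶠ q : ℝ × ℝ in 𝓝 (x, t), |q.1| < |x| + 1 :=
      (continuous_fst.abs).continuousAt.eventually_lt_const (lt_add_one _)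
    have h2 : ∀ᶠ q : ℝ × ℝ in 𝓝 (x, t), q.2 < t + 1 :=
      continuous_snd.continuousAt.eventually_lt_const (lt_add_one _)
    have htT : t ≤ max 1 (t + 1) := (by linarith : t ≤ t + 1).trans (le_max_right _ _)
    filter_upwards [h1, h2] with q hq1 hq2
    rw [norm_norm, Real.norm_eq_abs]
    have hqT : q.2 ≤ max 1 (t + 1) := hq2.le.trans (le_max_right _ _)
    have h3 := hL.lip_space x q.1 (by linarith) hq1.le q.2 hqT
    have h4 : |u x q.2 - u x t| ≤ L * |q.2 - t| := by
      rcases le_total q.2 t with h | h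
      · rw [abs_sub_comm, abs_sub_comm q.2, abs_of_nonneg (sub_nonneg.2 h)]
        exact hL.lip_time x (by linarith) _ _ h htT
      · rw [abs_of_nonneg (sub_nonneg.2 h)]
        exact hL.lip_time x (by linarith) _ _ h hqT
    exact (abs_sub_le _ (u x q.2) _).trans (add_le_add h3 h4)
  · have : Continuous fun q : ℝ × ℝ => L * |q.1 - x| + L * |q.2 - t| := by fun_prop
    simpa using this.tendsto (x, t)

theorem contDiff_two (hu : IsLimitSolution p A α β u) (H : IsAdmissible p m C a b A α β) (t : ℝ) :
    ContDiff ℝ 2 (fun x => u x t) ∧ ∀ x, deriv (deriv fun x => u x t) x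
      = curvature p A α β x (deriv (u x) t) (u x t) := by
  have hcont : Continuous fun x => u x t :=
    hu.continuous.comp (continuous_id.prodMk continuous_const)
  refine contDiff_two_of_schwarz hcont (H.continuous_curvature.comp
    (continuous_id.prodMk ((hu.continuous_deriv_left H t).prodMk hcont))) fun x => ?_
  refine hu.schwarz H fun δ hδ => ?_
  have h3 := hasDerivAt_iff_tendsto_slope.1 (hu.hasDerivAt_deriv H x t) |>.mono_left
    (nhdsWithin_mono t (show Ioi t ⊆ {t}ᶜ from fun y hy => ne_of_gt hy))
  obtain ⟨y, ⟨hy1, hy2⟩, hy3⟩ := (((Metric.tendsto_nhds.1 h3 δ hδ).and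
    (mem_nhdsWithin_of_mem_nhds (Iio_mem_nhds (lt_add_of_pos_right t hδ)))).and
      self_mem_nhdsWithin).exists
  have hy2' : y < t + δ := hy2
  have hy3' : t < y := hy3
  refine ⟨t, y, hy3, by linarith, ⟨le_rfl, hy3'.le⟩, ?_⟩
  rwa [slope_def_field, Real.dist_eq] at hy1

end IsLimitSolution

theorem IsAdmissible.exists_isLimitSolution {p m C a b : ℝ} {A α β : ℝ → ℝ}
    (H : IsAdmissible p m C a b A α β) :
    ∃ u, IsLimitSolution p A α β u ∧ (∀ x, u x 0 = 0) ∧ ∃ x, u x 1 ≠ 0 := by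
  have hex : ∀ n : ℕ, ∃ U, 1 ≤ n → IsGridSol p A α β n U := by
    intro n
    rcases Nat.eq_zero_or_pos n with h | h
    · exact ⟨fun _ _ => 0, by omega⟩
    · obtain ⟨U, hU⟩ := H.exists_isGridSol h
      exact ⟨U, fun _ => hU⟩
  choose U hU using hex
  have hB : ∀ X T : ℝ, 0 ≤ X → 1 ≤ T → ∃ L, 0 ≤ L ∧ ∃ n₀ : ℕ, ∀ n : ℕ, n₀ ≤ n →
      HasLocalBounds p A α β X T L n (U n) := by
    intro X T hX hT
    obtain ⟨L, hL0, n₀, hn₀, hL⟩ := H.exists_hasLocalBounds hX hT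
    exact ⟨L, hL0, n₀, fun n hn => hL n hn _ (hU n (hn₀.trans hn))⟩
  have hl := Nat.hyperfilter_le_atTop
  obtain ⟨u, hu⟩ := exists_isGridLimit hB (hyperfilter ℕ) hl
  refine ⟨u, ?_, ?_, ?_⟩
  · intro X T hX hT
    obtain ⟨L, hL0, n₀, hL⟩ := hB (X + 1) T (by linarith) hT
    exact ⟨L, hL0, hu.hasLimitBounds hl hL0 hL⟩
  · intro x
    refine tendsto_nhds_unique (hu x 0 _ ((tendsto_floor_mul_div_natCast x).mono_left hl))
      (tendsto_const_nhds.congr' ?_)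
    filter_upwards [hl (eventually_ge_atTop 1)] with n hn
    exact ((hU n hn).zero _ 0 le_rfl).symm
  · obtain ⟨δ, k, hδ, hk⟩ := H.exists_lower_bound
    refine ⟨k, ?_⟩
    have h1 : Tendsto (fun n : ℕ => U n (k * n) 1) (hyperfilter ℕ) (𝓝 (u k 1)) := by
      refine hu k 1 _ (tendsto_const_nhds.congr' ?_)
      filter_upwards [hl (eventually_ge_atTop 1)] with n hn
      have : (n : ℝ) ≠ 0 := by exact_mod_cast (by omega : n ≠ 0)
      push_cast
      field_simp
    have h2 : δ ≤ u k 1 := by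
      refine ge_of_tendsto h1 ?_
      filter_upwards [hl (eventually_ge_atTop (2 + k))] with n hn
      exact hk n (by omega) (by omega) _ (hU n (by omega))
    linarith

end

/-- Theorem EP3, part (2): `d = 1`, `L = A(x) d²/dx²` with
`A(x) ≥ C(1+|x|)^m`, `m > 1 + p`, `α` bounded, `β ≥ 0`: there is a nontrivial
nonnegative classical solution of `u_t = A u_xx + βu − αu^p` with zero initial data. -/
theorem stmt_5 (p : ℝ) (hp1 : 1 < p) (hp2 : p ≤ 2)
    (m : ℝ) (hm : 1 + p < m)
    (A : ℝ → ℝ) (hA_holder : LocHolder1 A) (hA_pos : ∀ x, 0 < A x)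
    (C : ℝ) (hC : 0 < C)
    (hA_lower : ∀ x : ℝ, C * (1 + |x|) ^ m ≤ A x)
    (α β : ℝ → ℝ)
    (hα_holder : LocHolder1 α) (hβ_holder : LocHolder1 β)
    (hα_pos : ∀ x, 0 < α x)
    (hα_bdd : ∃ M : ℝ, ∀ x, α x ≤ M)
    (hβ_nonneg : ∀ x, 0 ≤ β x)
    (hβ_bdd : ∃ M : ℝ, ∀ x, β x ≤ M) :
    ∃ u : ℝ → ℝ → ℝ,
      ContinuousOn (fun q : ℝ × ℝ => u q.1 q.2) (univ ×ˢ Ici (0 : ℝ)) ∧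
      (∀ x t, 0 ≤ t → 0 ≤ u x t) ∧
      (∀ t : ℝ, 0 < t → ContDiff ℝ 2 (fun x => u x t)) ∧
      (∀ x, ContDiffOn ℝ 1 (fun s => u x s) (Ioi (0 : ℝ))) ∧
      (∀ x t, 0 < t →
        deriv (fun s => u x s) t =
          A x * deriv (deriv (fun y => u y t)) x
            + β x * u x t - α x * u x t ^ p) ∧
      (∀ x, u x 0 = 0) ∧
      (∃ x t, 0 ≤ t ∧ u x t ≠ 0) := by
  obtain ⟨a, ha⟩ := hα_bdd
  obtain ⟨b, hb⟩ := hβ_bdd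
  have H : IsAdmissible p m C a b A α β :=
    ⟨hp1, hp2, hm, hA_holder.continuous, hα_holder.continuous, hβ_holder.continuous, hC, hA_pos,
      hA_lower, hα_pos, ha, hβ_nonneg, hb⟩
  obtain ⟨u, hu, hu0, x₀, hx₀⟩ := H.exists_isLimitSolution
  refine ⟨u, hu.continuous.continuousOn, fun x t _ => hu.nonneg x t,
    fun t _ => (hu.contDiff_two H t).1, fun x => ?_, fun x t _ => ?_, hu0,
    x₀, 1, zero_le_one, hx₀⟩
  · exact (contDiff_one_iff_deriv.2
      ⟨fun t => (hu.hasDerivAt_deriv H x t).differentiableAt, hu.continuous_deriv H x⟩).contDiffOn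
  · rw [(hu.contDiff_two H t).2 x, curvature, mul_div_cancel₀ _ (hA_pos x).ne']
    ring
end

section
/- Let d = 1, p ∈ (1,2], m ≤ 1 + p, and let A : ℝ → ℝ be locally Hölder continuous and positive with A(x) ≤ C(1+|x|)^m for all x and some C > 0. Let α, β : ℝ → ℝ be locally Hölder continuous with inf_{x∈ℝ} α(x) > 0 and β ≤ 0. Then the only function u : ℝ × [0,∞) → ℝ that is continuous, nonnegative, twice continuously differentiable in x and once in t on ℝ × (0,∞), satisfies ∂u/∂t = A(x)u_{xx} + β(x)u − α(x)u^p on ℝ × (0,∞), and satisfies u(x,0) = 0 for all x ∈ ℝ, is u ≡ 0. -/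
open Set

open Filter Topology

/-- At an interior maximum of `v - φ` the second derivative of `v` is at most that of `φ`. -/
lemma deriv_deriv_le_of_isLocalMax_sub {v φ φ' : ℝ → ℝ} {c x₀ : ℝ} (hv : ContDiff ℝ 2 v)
    (hφ : ∀ᶠ x in 𝓝 x₀, HasDerivAt φ (φ' x) x) (hφ' : HasDerivAt φ' c x₀)
    (hmax : IsLocalMax (fun x => v x - φ x) x₀) : deriv (deriv v) x₀ ≤ c := by
  have hv1 : Differentiable ℝ v := hv.differentiable (by norm_num)
  have hv2 : Differentiable ℝ (deriv v) := by
    have h : ContDiff ℝ 1 (deriv v) := (contDiff_succ_iff_deriv (n := 1).1 hv).2.2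
    exact h.differentiable (by norm_num)
  have hd : deriv (fun x => v x - φ x) =ᶠ[𝓝 x₀] fun x => deriv v x - φ' x := by
    filter_upwards [hφ] with x hx
    exact ((hv1 x).hasDerivAt.sub hx).deriv
  have hdd : deriv (deriv fun x => v x - φ x) x₀ = deriv (deriv v) x₀ - c := by
    rw [hd.deriv_eq]
    exact ((hv2 x₀).hasDerivAt.sub hφ').deriv
  by_contra! hlt
  have hmin : IsLocalMin (fun x => v x - φ x) x₀ :=
    isLocalMin_of_deriv_deriv_pos (by rw [hdd]; linarith) hmax.deriv_eq_zero
      ((hv1 x₀).continuousAt.sub hφ.self_of_nhds.continuousAt)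
  have hconst : (fun x => v x - φ x) =ᶠ[𝓝 x₀] fun _ => v x₀ - φ x₀ := by
    filter_upwards [hmax, hmin] with x h1 h2
    exact le_antisymm h1 h2
  have hz : deriv (deriv fun x => v x - φ x) x₀ = 0 := by
    rw [hconst.deriv.deriv_eq]
    simp
  linarith

/-- A function attaining its maximum over an interval at the right end has nonnegative derivative
there. -/
lemma deriv_nonneg_of_le_left {f : ℝ → ℝ} {a t : ℝ} (hat : a < t) (hf : DifferentiableAt ℝ f t)
    (hle : ∀ s ∈ Icc a t, f s ≤ f t) : 0 ≤ deriv f t := by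
  have hlim := (hasDerivAt_iff_tendsto_slope.1 hf.hasDerivAt).mono_left
    (nhdsWithin_mono t (fun s (hs : s < t) => hs.ne) : 𝓝[<] t ≤ 𝓝[≠] t)
  refine ge_of_tendsto hlim ?_
  filter_upwards [Ioo_mem_nhdsLT hat] with s hs
  rw [slope_def_field]
  exact div_nonneg_of_nonpos (by linarith [hle s ⟨hs.1.le, hs.2.le⟩]) (by linarith [hs.2])

/-- The logarithmic distance from `x` to the blow-up points `√(1 + x²) = exp S`. -/
noncomputable def logGap (S x : ℝ) : ℝ := S - Real.log √(1 + x ^ 2)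

lemma one_le_sqrt_one_add_sq (x : ℝ) : 1 ≤ √(1 + x ^ 2) :=
  Real.one_le_sqrt.2 (by nlinarith [sq_nonneg x])

lemma continuous_logGap (S : ℝ) : Continuous (logGap S) := by
  unfold logGap
  refine continuous_const.sub (Continuous.log (by fun_prop) fun x => ?_)
  linarith [one_le_sqrt_one_add_sq x]

lemma hasDerivAt_sqrt_one_add_sq (x : ℝ) :
    HasDerivAt (fun y : ℝ => √(1 + y ^ 2)) (x / √(1 + x ^ 2)) x := by
  have h := (((hasDerivAt_id x).pow 2).const_add 1).sqrt
    (by simp only [id, Pi.pow_apply]; nlinarith [sq_nonneg x])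
  convert h using 1
  have := one_le_sqrt_one_add_sq x
  simp only [id, Pi.pow_apply]
  norm_num
  field_simp

lemma hasDerivAt_logGap (S x : ℝ) :
    HasDerivAt (logGap S) (-(x / √(1 + x ^ 2) / √(1 + x ^ 2))) x :=
  ((hasDerivAt_sqrt_one_add_sq x).log (by linarith [one_le_sqrt_one_add_sq x])).const_sub S

lemma hasDerivAt_logGap_rpow (S r : ℝ) {x : ℝ} (hx : 0 < logGap S x) :
    HasDerivAt (fun y => logGap S y ^ r)
      (-(x / √(1 + x ^ 2) / √(1 + x ^ 2)) * r * logGap S x ^ (r - 1)) x :=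
  (hasDerivAt_logGap S x).rpow_const (Or.inl hx.ne')

/-- The derivative of `√(1 + x²) * logGap S x ^ (-q)`. -/
noncomputable def barrierDeriv (q S x : ℝ) : ℝ :=
  x / √(1 + x ^ 2) * (logGap S x ^ (-q) + q * logGap S x ^ (-q - 1))

lemma hasDerivAt_barrier (q S : ℝ) {x : ℝ} (hx : 0 < logGap S x) :
    HasDerivAt (fun y => √(1 + y ^ 2) * logGap S y ^ (-q)) (barrierDeriv q S x) x := by
  refine ((hasDerivAt_sqrt_one_add_sq x).mul (hasDerivAt_logGap_rpow S (-q) hx)).congr_deriv ?_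
  have := one_le_sqrt_one_add_sq x
  unfold barrierDeriv
  field_simp

lemma hasDerivAt_barrierDeriv (q S : ℝ) {x : ℝ} (hx : 0 < logGap S x) :
    HasDerivAt (barrierDeriv q S)
      (1 / √(1 + x ^ 2) ^ 3 * (logGap S x ^ (-q) + q * (logGap S x ^ (-q) / logGap S x)) +
        x ^ 2 / √(1 + x ^ 2) ^ 3 * (q * (logGap S x ^ (-q) / logGap S x) +
          q * (q + 1) * (logGap S x ^ (-q) / logGap S x ^ 2))) x := by
  have h1 := one_le_sqrt_one_add_sq x
  have hsq : √(1 + x ^ 2) ^ 2 = 1 + x ^ 2 := Real.sq_sqrt (by positivity)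
  have e1 : logGap S x ^ (-q - 1) = logGap S x ^ (-q) / logGap S x := Real.rpow_sub_one hx.ne' _
  have e2 : logGap S x ^ (-q - 1 - 1) = logGap S x ^ (-q) / logGap S x ^ 2 := by
    rw [Real.rpow_sub_one hx.ne', e1]; field_simp
  have h := ((hasDerivAt_id x).div (hasDerivAt_sqrt_one_add_sq x) (by linarith)).mul
    ((hasDerivAt_logGap_rpow S (-q) hx).add ((hasDerivAt_logGap_rpow S (-q - 1) hx).const_mul q))
  refine h.congr_deriv ?_
  simp only [id, Pi.add_apply, Pi.div_apply, e1, e2]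
  have e3 : (1 * √(1 + x ^ 2) - x * (x / √(1 + x ^ 2))) / √(1 + x ^ 2) ^ 2
      = 1 / √(1 + x ^ 2) ^ 3 := by
    field_simp
    linarith
  rw [e3]
  field_simp
  ring

/-- The algebraic inequality behind the supersolution property of
`δ + k * √(1 + x²) * logGap S x ^ (-q)`. -/
lemma barrier_algebra {p q η S δ G h D x : ℝ} (hp1 : 1 < p) (hp2 : p ≤ 2) (hq : q = 2 / (p - 1))
    (hη : 0 < η) (hδ : 0 < δ) (hG : G = 2 * (2 * q * S + q * (q + 1)) / η)
    (hτ : G ^ (1 / (p - 1)) * (S / 2) ^ (-q) ≤ η / 2 * δ ^ p)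
    (hh : 1 ≤ h) (hx : x ^ 2 ≤ h ^ 2) (hD : 0 < D) (hDS : D = S - Real.log h) :
    h ^ (1 + p) * (G ^ (1 / (p - 1)) *
      (1 / h ^ 3 * (D ^ (-q) + q * (D ^ (-q) / D)) +
        x ^ 2 / h ^ 3 * (q * (D ^ (-q) / D) + q * (q + 1) * (D ^ (-q) / D ^ 2))))
      ≤ η * (δ + G ^ (1 / (p - 1)) * (h * D ^ (-q))) ^ p := by
  have hp : 0 < p - 1 := by linarith
  have hq2 : 2 ≤ q := by rw [hq, le_div_iff₀ hp]; linarith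
  have hlog : 0 ≤ Real.log h := Real.log_nonneg hh
  have hSD : D ≤ S := by linarith
  have hSpos : 0 < S := by linarith
  have hGpos : 0 < G := by rw [hG]; positivity
  set k := G ^ (1 / (p - 1)) with hk
  have hkpos : 0 < k := Real.rpow_pos_of_pos hGpos _
  have hkp : k ^ p = k * G := by
    have : k ^ (p - 1) = G := by
      rw [hk, ← Real.rpow_mul hGpos.le, one_div_mul_cancel hp.ne', Real.rpow_one]
    rw [← this, ← Real.rpow_one_add' hkpos.le (by linarith)]
    congr 1; ring
  set P := D ^ (-q) with hP
  have hPpos : 0 < P := Real.rpow_pos_of_pos hD _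
  have hPp : P ^ p = P / D ^ 2 := by
    rw [hP, ← Real.rpow_mul hD.le, ← Real.rpow_natCast D 2, ← Real.rpow_sub hD]
    congr 1
    rw [hq]; field_simp; push_cast; ring
  have hhpos : 0 < h := by linarith
  have hmain : (k * (h * P)) ^ p = k * G * (h ^ p * (P / D ^ 2)) := by
    rw [Real.mul_rpow hkpos.le (by positivity), Real.mul_rpow hhpos.le hPpos.le, hkp, hPp]
  have hle : (k * (h * P)) ^ p ≤ (δ + k * (h * P)) ^ p :=
    Real.rpow_le_rpow (by positivity) (by linarith) (by linarith)
  have hle' : δ ^ p ≤ (δ + k * (h * P)) ^ p :=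
    Real.rpow_le_rpow hδ.le (le_add_of_nonneg_right (by positivity)) (by linarith)
  have hh1 : h ^ (1 + p) = h * h ^ p := Real.rpow_one_add' hhpos.le (by linarith)
  have hηG : η * G / 2 = 2 * q * S + q * (q + 1) := by rw [hG]; field_simp
  have hhp : 0 < h ^ p := Real.rpow_pos_of_pos hhpos _
  have hx1 : x ^ 2 / h ^ 3 ≤ 1 / h := by
    rw [div_le_div_iff₀ (by positivity) hhpos]; nlinarith
  have hx2 : 1 / h ^ 3 ≤ 1 / h := by
    apply one_div_le_one_div_of_le hhpos
    exact le_self_pow₀ hh (by norm_num)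
  have hsplit : h ^ (1 + p) * (k * (1 / h ^ 3 * (P + q * (P / D)) +
        x ^ 2 / h ^ 3 * (q * (P / D) + q * (q + 1) * (P / D ^ 2))))
      ≤ k * P * (h ^ p / h ^ 2) + k * h ^ p * (P / D ^ 2) * (2 * q * D + q * (q + 1)) := by
    have a1 : 1 / h ^ 3 * (q * (P / D)) ≤ 1 / h * (q * (P / D)) :=
      mul_le_mul_of_nonneg_right hx2 (by positivity)
    have a2 : x ^ 2 / h ^ 3 * (q * (P / D) + q * (q + 1) * (P / D ^ 2))
        ≤ 1 / h * (q * (P / D) + q * (q + 1) * (P / D ^ 2)) :=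
      mul_le_mul_of_nonneg_right hx1 (by positivity)
    calc _ ≤ h * h ^ p * (k * (1 / h ^ 3 * P + 1 / h * (q * (P / D)) +
          1 / h * (q * (P / D) + q * (q + 1) * (P / D ^ 2)))) := by
          rw [hh1]; gcongr; linarith
      _ = _ := by field_simp; ring
  have hsecond : k * h ^ p * (P / D ^ 2) * (2 * q * D + q * (q + 1))
      ≤ η / 2 * (k * (h * P)) ^ p := by
    calc _ ≤ k * h ^ p * (P / D ^ 2) * (η * G / 2) := by
          rw [hηG]; gcongr
      _ = _ := by rw [hmain]; ring
  have hfirst : k * P * (h ^ p / h ^ 2) ≤ η / 2 * (δ + k * (h * P)) ^ p := by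
    rcases le_total (S / 2) D with hcase | hcase
    · have b1 : h ^ p / h ^ 2 ≤ 1 := by
        rw [div_le_one (by positivity), ← Real.rpow_natCast h 2]
        exact Real.rpow_le_rpow_of_exponent_le hh (by exact_mod_cast hp2)
      have b2 : P ≤ (S / 2) ^ (-q) :=
        Real.rpow_le_rpow_of_nonpos (by linarith) hcase (by linarith)
      calc _ ≤ k * (S / 2) ^ (-q) * 1 := by
            gcongr
        _ ≤ η / 2 * δ ^ p := by linarith
        _ ≤ _ := by gcongr
    · have b1 : D ≤ h := by linarith [Real.log_le_self hhpos.le]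
      have b2 : 1 ≤ η * G / 2 := by rw [hηG]; nlinarith
      calc k * P * (h ^ p / h ^ 2) ≤ k * P * (h ^ p / D ^ 2) * 1 := by
            rw [mul_one]; gcongr
        _ ≤ k * P * (h ^ p / D ^ 2) * (η * G / 2) := by gcongr
        _ = η / 2 * (k * (h * P)) ^ p := by rw [hmain]; ring
        _ ≤ _ := by gcongr
  calc _ ≤ _ := hsplit
    _ ≤ η / 2 * (δ + k * (h * P)) ^ p + η / 2 * (δ + k * (h * P)) ^ p := by
      refine add_le_add hfirst (hsecond.trans ?_)
      gcongr
    _ = _ := by ring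

/-- The amplitude of the barrier on bounded sets vanishes as the blow-up points move to infinity. -/
lemma tendsto_barrier_amplitude {p q η : ℝ} (hp1 : 1 < p) (hq : q = 2 / (p - 1)) (hη : 0 < η) :
    Tendsto (fun S : ℝ => (2 * (2 * q * S + q * (q + 1)) / η) ^ (1 / (p - 1)) * (S / 2) ^ (-q))
      atTop (𝓝 0) := by
  have hp : 0 < p - 1 := by linarith
  have hqpos : 0 < q := by rw [hq]; positivity
  have hinv : Tendsto (fun S : ℝ => S⁻¹) atTop (𝓝 0) := tendsto_inv_atTop_zero
  have hbase : Tendsto (fun S : ℝ => 8 / η * (2 * q * S⁻¹ + q * (q + 1) * (S⁻¹ * S⁻¹)))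
      atTop (𝓝 0) := by
    simpa using (((hinv.const_mul (2 * q)).add ((hinv.mul hinv).const_mul (q * (q + 1)))).const_mul
      (8 / η))
  have hpow := hbase.rpow_const (p := 1 / (p - 1)) (Or.inr (by positivity))
  rw [Real.zero_rpow (by positivity)] at hpow
  refine hpow.congr' ?_
  filter_upwards [eventually_gt_atTop 0] with S hS
  have e : (S / 2) ^ (-q) = ((S / 2) ^ (-2 : ℝ)) ^ (1 / (p - 1)) := by
    rw [← Real.rpow_mul (by positivity)]
    congr 1
    rw [hq]; ring
  rw [e, ← Real.mul_rpow (by positivity) (by positivity), Real.rpow_neg (by positivity),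
    Real.rpow_two]
  congr 1
  field_simp
  ring

/-- Theorem EP3, part (3): `d = 1`, `L = A(x) d²/dx²` with
`A(x) ≤ C(1+|x|)^m`, `m ≤ 1 + p`, `inf α > 0`, `β ≤ 0`: the only nonnegative
classical solution of `u_t = A u_xx + βu − αu^p` with zero initial data is `u ≡ 0`. -/
theorem stmt_6 (p : ℝ) (hp1 : 1 < p) (hp2 : p ≤ 2)
    (m : ℝ) (hm : m ≤ 1 + p)
    (A : ℝ → ℝ) (hA_holder : LocHolder1 A) (hA_pos : ∀ x, 0 < A x)
    (C : ℝ) (hC : 0 < C)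
    (hA_upper : ∀ x : ℝ, A x ≤ C * (1 + |x|) ^ m)
    (α β : ℝ → ℝ)
    (hα_holder : LocHolder1 α) (hβ_holder : LocHolder1 β)
    (hα_inf : ∃ ε : ℝ, 0 < ε ∧ ∀ x, ε ≤ α x)
    (hβ_nonpos : ∀ x, β x ≤ 0)
    (u : ℝ → ℝ → ℝ)
    (hu_cont : ContinuousOn (fun q : ℝ × ℝ => u q.1 q.2) (univ ×ˢ Ici (0 : ℝ)))
    (hu_nonneg : ∀ x t, 0 ≤ t → 0 ≤ u x t)
    (hu_x : ∀ t : ℝ, 0 < t → ContDiff ℝ 2 (fun x => u x t))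
    (hu_t : ∀ x, ContDiffOn ℝ 1 (fun s => u x s) (Ioi (0 : ℝ)))
    (hpde : ∀ x t, 0 < t →
      deriv (fun s => u x s) t =
        A x * deriv (deriv (fun y => u y t)) x
          + β x * u x t - α x * u x t ^ p)
    (hinit : ∀ x, u x 0 = 0) :
    ∀ x t, 0 ≤ t → u x t = 0 := by
  obtain ⟨ε, hε, hαε⟩ := hα_inf
  set K : ℝ := C * 2 ^ (1 + p) with hK
  have hKpos : 0 < K := by positivity
  set η : ℝ := ε / K with hηdef
  have hη : 0 < η := by positivity
  set q : ℝ := 2 / (p - 1) with hq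
  have hp : 0 < p - 1 := by linarith
  have hqpos : 0 < q := by positivity
  have hAK : ∀ x, A x ≤ K * √(1 + x ^ 2) ^ (1 + p) := by
    intro x
    have h1 := one_le_sqrt_one_add_sq x
    have h2 : |x| ≤ √(1 + x ^ 2) := Real.abs_le_sqrt (by linarith)
    calc A x ≤ C * (1 + |x|) ^ m := hA_upper x
      _ ≤ C * (1 + |x|) ^ (1 + p) := by
        gcongr
        linarith [abs_nonneg x]
      _ ≤ C * (2 * √(1 + x ^ 2)) ^ (1 + p) := by
        gcongr
        linarith
      _ = _ := by rw [Real.mul_rpow (by norm_num) (by positivity), hK]; ring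
  have hbound : ∀ δ : ℝ, 0 < δ → ∀ S : ℝ, 0 < S →
      (2 * (2 * q * S + q * (q + 1)) / η) ^ (1 / (p - 1)) * (S / 2) ^ (-q) ≤ η / 2 * δ ^ p →
      ∀ x T, 0 ≤ T → 0 < logGap S x →
      u x T ≤ δ + (2 * (2 * q * S + q * (q + 1)) / η) ^ (1 / (p - 1)) *
        (√(1 + x ^ 2) * logGap S x ^ (-q)) := by
    intro δ hδ S hS hτ x T hT hx
    set k := (2 * (2 * q * S + q * (q + 1)) / η) ^ (1 / (p - 1)) with hk
    have hkpos : 0 < k := by positivity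
    have hcont : ∀ s : Set ℝ, ContinuousOn (fun z : ℝ × ℝ => u z.1 z.2) (s ×ˢ Icc 0 T) :=
      fun s => hu_cont.mono (prod_mono (subset_univ _) fun t ht => ht.1)
    obtain ⟨M, hM⟩ := ((isCompact_Icc (a := -Real.exp S) (b := Real.exp S)).prod
      (isCompact_Icc (a := 0) (b := T))).bddAbove_image (hcont _)
    have hlim : Tendsto (fun d : ℝ => k * d ^ (-q)) (𝓝[>] 0) atTop :=
      (tendsto_rpow_neg_nhdsGT_zero (neg_lt_zero.2 hqpos)).const_mul_atTop hkpos
    obtain ⟨d, ⟨hdM, hdx⟩, hd⟩ := (((hlim.eventually_ge_atTop M).and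
      ((eventually_lt_nhds hx).filter_mono nhdsWithin_le_nhds)).and
      (self_mem_nhdsWithin : Ioi (0 : ℝ) ∈ 𝓝[>] 0)).exists
    have hsub : {y | d ≤ logGap S y} ⊆ Icc (-Real.exp S) (Real.exp S) := by
      intro y hy
      have h1 := one_le_sqrt_one_add_sq y
      have h2 : |y| ≤ √(1 + y ^ 2) := Real.abs_le_sqrt (by linarith)
      have h3 : √(1 + y ^ 2) ≤ Real.exp S := by
        rw [← Real.log_le_iff_le_exp (by linarith)]
        have : d ≤ S - Real.log √(1 + y ^ 2) := hy
        linarith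
      exact abs_le.1 (h2.trans h3)
    have hcpt : IsCompact {y | d ≤ logGap S y} :=
      isCompact_Icc.of_isClosed_subset (isClosed_le continuous_const (continuous_logGap S)) hsub
    have hφcont : ContinuousOn (fun y => δ + k * (√(1 + y ^ 2) * logGap S y ^ (-q)))
        {y | d ≤ logGap S y} := fun y hy =>
      (((hasDerivAt_barrier q S (hd.trans_le hy)).continuousAt.const_mul k).const_add
        δ).continuousWithinAt
    obtain ⟨⟨y, t⟩, ⟨hy, ht⟩, hmax⟩ := (hcpt.prod (isCompact_Icc (a := 0) (b := T))).exists_isMaxOn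
      ⟨(x, T), hdx.le, hT, le_rfl⟩ ((hcont _).sub (hφcont.comp continuousOn_fst fun z hz => hz.1))
    simp only [mem_ofPred_eq] at hy ht
    have hy0 : 0 < logGap S y := hd.trans_le hy
    have hle : ∀ z s, d ≤ logGap S z → 0 ≤ s → s ≤ T →
        u z s - (δ + k * (√(1 + z ^ 2) * logGap S z ^ (-q))) ≤
          u y t - (δ + k * (√(1 + y ^ 2) * logGap S y ^ (-q))) :=
      fun z s hz hs hsT => hmax (show (z, s) ∈ _ from ⟨hz, hs, hsT⟩)
    by_contra! hlt
    have hpos : δ + k * (√(1 + y ^ 2) * logGap S y ^ (-q)) < u y t := by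
      linarith [hle x T hdx.le hT le_rfl]
    have h1 := one_le_sqrt_one_add_sq y
    have hφpos : 0 < k * (√(1 + y ^ 2) * logGap S y ^ (-q)) := by positivity
    have ht0 : 0 < t := by
      rcases ht.1.eq_or_lt with h | h
      · rw [← h, hinit] at hpos; linarith
      · exact h
    have hdy : d < logGap S y := by
      refine lt_of_le_of_ne hy fun h => ?_
      have hMu : u y t ≤ M := hM ⟨(y, t), ⟨hsub hy, ht⟩, rfl⟩
      rw [← h] at hpos
      have : k * d ^ (-q) ≤ k * (√(1 + y ^ 2) * d ^ (-q)) := by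
        gcongr
        exact le_mul_of_one_le_left (by positivity) h1
      linarith
    have hut : 0 ≤ deriv (fun s => u y s) t := by
      refine deriv_nonneg_of_le_left ht0
        (((hu_t y).differentiableOn (by norm_num)).differentiableAt (Ioi_mem_nhds ht0)) ?_
      intro s hs
      have := hle y s hy hs.1 (hs.2.trans ht.2)
      linarith
    have hnear : ∀ᶠ z in 𝓝 y, d < logGap S z :=
      (continuous_logGap S).continuousAt.eventually (eventually_gt_nhds hdy)
    have huxx := deriv_deriv_le_of_isLocalMax_sub (hu_x t ht0)
      (hnear.mono fun z hz => ((hasDerivAt_barrier q S (hd.trans hz)).const_mul k).const_add δ)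
      ((hasDerivAt_barrierDeriv q S hy0).const_mul k)
      (hnear.mono fun z hz => hle z t hz.le ht.1 ht.2)
    have hsq : √(1 + y ^ 2) ^ 2 = 1 + y ^ 2 := Real.sq_sqrt (by positivity)
    have halg := barrier_algebra (x := y) hp1 hp2 hq hη hδ rfl hτ h1 (by linarith) hy0 rfl
    rw [← hk] at halg
    have hnn : 0 ≤ k * (1 / √(1 + y ^ 2) ^ 3 *
          (logGap S y ^ (-q) + q * (logGap S y ^ (-q) / logGap S y)) +
        y ^ 2 / √(1 + y ^ 2) ^ 3 * (q * (logGap S y ^ (-q) / logGap S y) +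
          q * (q + 1) * (logGap S y ^ (-q) / logGap S y ^ 2))) := by positivity
    set B := k * (1 / √(1 + y ^ 2) ^ 3 *
          (logGap S y ^ (-q) + q * (logGap S y ^ (-q) / logGap S y)) +
        y ^ 2 / √(1 + y ^ 2) ^ 3 * (q * (logGap S y ^ (-q) / logGap S y) +
          q * (q + 1) * (logGap S y ^ (-q) / logGap S y ^ 2))) with hB
    have hpow : (δ + k * (√(1 + y ^ 2) * logGap S y ^ (-q))) ^ p < u y t ^ p :=
      Real.rpow_lt_rpow (by linarith) hpos (by linarith)
    have hKη : K * η = ε := by rw [hηdef]; field_simp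
    have hdiff : A y * deriv (deriv fun y => u y t) y < ε * u y t ^ p := by
      calc A y * deriv (deriv fun y => u y t) y ≤ A y * B :=
            mul_le_mul_of_nonneg_left huxx (hA_pos y).le
        _ ≤ K * √(1 + y ^ 2) ^ (1 + p) * B := mul_le_mul_of_nonneg_right (hAK y) hnn
        _ = K * (√(1 + y ^ 2) ^ (1 + p) * B) := by ring
        _ ≤ K * (η * (δ + k * (√(1 + y ^ 2) * logGap S y ^ (-q))) ^ p) := by gcongr
        _ = ε * (δ + k * (√(1 + y ^ 2) * logGap S y ^ (-q))) ^ p := by rw [← hKη]; ring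
        _ < _ := by gcongr
    have hβu : β y * u y t ≤ 0 := mul_nonpos_of_nonpos_of_nonneg (hβ_nonpos y) (hu_nonneg y t ht.1)
    have hαu : ε * u y t ^ p ≤ α y * u y t ^ p :=
      mul_le_mul_of_nonneg_right (hαε y) (Real.rpow_nonneg (hu_nonneg y t ht.1) p)
    have := hpde y t ht0
    linarith
  intro x t ht
  refine le_antisymm (le_of_forall_pos_le_add fun δ hδ => ?_) (hu_nonneg x t ht)
  have hlim := tendsto_barrier_amplitude hp1 hq hη
  have h1 := one_le_sqrt_one_add_sq x
  have hδ2 : 0 < δ / 2 := by positivity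
  obtain ⟨S, ⟨⟨hS1, hS2⟩, hS3⟩, hS⟩ := (((hlim.eventually_le_const
    (show 0 < η / 2 * (δ / 2) ^ p by positivity)).and
    (hlim.eventually_le_const (show 0 < δ / 2 / √(1 + x ^ 2) by positivity))).and
    (eventually_ge_atTop (2 * Real.log √(1 + x ^ 2)))).and (eventually_gt_atTop 0) |>.exists
  have hgap : S / 2 ≤ logGap S x := by unfold logGap; linarith
  refine (hbound (δ / 2) hδ2 S hS hS1 x t ht (by linarith)).trans ?_
  have hpow : logGap S x ^ (-q) ≤ (S / 2) ^ (-q) :=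
    Real.rpow_le_rpow_of_nonpos (by positivity) hgap (by linarith)
  set k := (2 * (2 * q * S + q * (q + 1)) / η) ^ (1 / (p - 1)) with hk
  have hkpos : 0 < k := by positivity
  rw [le_div_iff₀ (by positivity)] at hS2
  have : k * (√(1 + x ^ 2) * logGap S x ^ (-q)) ≤ k * (S / 2) ^ (-q) * √(1 + x ^ 2) := by
    calc _ ≤ k * (√(1 + x ^ 2) * (S / 2) ^ (-q)) := by gcongr
      _ = _ := by ring
  linarith
end
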